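/- arXiv:1704.00971 — 4 statements merged into one kernel-verified Lean document; each statement's English description precedes it below -/
import Mathlib

section
/- Let m:(0,∞)→[0,1] be measurable and suppose that the energy Q(m(r)dr) is finite. Then m admits a generalized derivative: there exists a locally integrable function g:(0,∞)→ℝ such that ∫₀^∞ G'(r) m(r) dr = −∫₀^∞ G(r) g(r) dr for every G ∈ C¹_K((0,∞)); moreover Q(m(r)dr) = (1/4) ∫₀^∞ g(r)² / (m(r)(1−m(r))) dr, with the convention that the integrand vanishes where g = 0. -/
open MeasureTheory Set Filter
open scoped ENNReal

noncomputable section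

/-- `G` is continuously differentiable with compact support contained in `(0, ∞)`. -/
def IsC1K (G : ℝ → ℝ) : Prop :=
  ContDiff ℝ 1 G ∧ HasCompactSupport G ∧ tsupport G ⊆ Set.Ioi 0

/-- The expression inside the supremum defining the energy:
`-∫₀^∞ G'(r) m(r) dr - ∫₀^∞ σ(m(r)) G(r)² dr` with `σ(a) = a(1-a)`. -/
def energyExpr (m G : ℝ → ℝ) : ℝ :=
  (- ∫ r in Set.Ioi (0:ℝ), deriv G r * m r)
    - ∫ r in Set.Ioi (0:ℝ), (m r * (1 - m r)) * (G r) ^ 2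

/-- The energy functional `Q(m(r)dr)`, with values in `ℝ≥0∞`. -/
def energy (m : ℝ → ℝ) : ℝ≥0∞ :=
  ⨆ G : {G : ℝ → ℝ // IsC1K G}, ENNReal.ofReal (energyExpr m G.1)


theorem riesz_aux {V H : Type*} [AddCommGroup V] [Module ℝ V] [NormedAddCommGroup H]
    [InnerProductSpace ℝ H] [CompleteSpace H] (T : V →ₗ[ℝ] H) (l : V →ₗ[ℝ] ℝ) (c : ℝ)
    (hc : ∀ v, |l v| ≤ c * ‖T v‖) :
    ∃ h : H, h ∈ closure (Set.range T) ∧ ∀ v, l v = inner ℝ h (T v) := by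
  have hker : LinearMap.ker T ≤ LinearMap.ker l := by
    intro v hv
    have h1 := hc v
    rw [LinearMap.mem_ker] at hv ⊢
    rw [hv, norm_zero, mul_zero] at h1
    exact abs_nonpos_iff.mp h1
  let f0 : LinearMap.range T →ₗ[ℝ] ℝ :=
    ((LinearMap.ker T).liftQ l hker) ∘ₗ (T.quotKerEquivRange.symm : _ →ₗ[ℝ] _)
  have hf0 : ∀ v, f0 ⟨T v, LinearMap.mem_range_self T v⟩ = l v := by
    intro v
    simp only [f0, LinearMap.comp_apply, LinearEquiv.coe_coe]
    rw [LinearMap.quotKerEquivRange_symm_apply_image]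
    simp
  let f1 : StrongDual ℝ (LinearMap.range T) := f0.mkContinuous c (by
    rintro ⟨x, v, rfl⟩
    rw [hf0]
    exact hc v)
  obtain ⟨F, hF, -⟩ := exists_extension_norm_eq (LinearMap.range T) f1
  let h0 : H := (InnerProductSpace.toDual ℝ H).symm F
  have hh0 : ∀ v, l v = inner ℝ h0 (T v) := by
    intro v
    rw [InnerProductSpace.toDual_symm_apply]
    have := hF ⟨T v, LinearMap.mem_range_self T v⟩
    rw [this]
    exact (hf0 v).symm
  let K : Submodule ℝ H := (LinearMap.range T).topologicalClosure
  have : CompleteSpace K := (Submodule.isClosed_topologicalClosure _).completeSpace_coe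
  refine ⟨K.starProjection h0, ?_, ?_⟩
  · have : K.starProjection h0 ∈ K := Submodule.starProjection_apply_mem _ _
    rwa [← SetLike.mem_coe, Submodule.topologicalClosure_coe, LinearMap.coe_range] at this
  · intro v
    have hv : T v ∈ K := Submodule.le_topologicalClosure _ (LinearMap.mem_range_self T v)
    have := Submodule.starProjection_inner_eq_zero (K := K) h0 (T v) hv
    rw [inner_sub_left] at this
    rw [hh0]
    linarith

theorem quad_aux {V H : Type*} [AddCommGroup V] [Module ℝ V] [NormedAddCommGroup H]
    [InnerProductSpace ℝ H] [CompleteSpace H] (T : V →ₗ[ℝ] H) (l : V →ₗ[ℝ] ℝ)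
    (hfin : (⨆ v, ENNReal.ofReal (l v - ‖T v‖ ^ 2)) ≠ ⊤) :
    ∃ h : H, (∀ v, l v = inner ℝ h (T v)) ∧
      (⨆ v, ENNReal.ofReal (l v - ‖T v‖ ^ 2)) = ENNReal.ofReal ((1/4) * ‖h‖ ^ 2) := by
  set Q := ⨆ v, ENNReal.ofReal (l v - ‖T v‖ ^ 2) with hQ
  have hb : ∀ v, l v - ‖T v‖ ^ 2 ≤ Q.toReal := by
    intro v
    refine (ENNReal.ofReal_le_iff_le_toReal hfin).mp ?_
    exact le_iSup (fun v => ENNReal.ofReal (l v - ‖T v‖ ^ 2)) v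
  have hc : ∀ v, |l v| ≤ (2 * √Q.toReal) * ‖T v‖ := by
    intro v
    have h1 : ∀ x : ℝ, 0 ≤ ‖T v‖ ^ 2 * (x * x) + (- l v) * x + Q.toReal := by
      intro x
      have := hb (x • v)
      rw [map_smul, map_smul, norm_smul, mul_pow, smul_eq_mul, Real.norm_eq_abs, sq_abs] at this
      nlinarith
    have h2 := discrim_le_zero h1
    rw [discrim] at h2
    refine abs_le_of_sq_le_sq ?_ (by positivity)
    have := Real.sq_sqrt (ENNReal.toReal_nonneg (a := Q))
    rw [mul_pow, mul_pow, this]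
    nlinarith
  obtain ⟨h, hcl, hh⟩ := riesz_aux T l _ hc
  have key : ∀ v, l v - ‖T v‖ ^ 2 = (1/4) * ‖h‖ ^ 2 - ‖T v - (1/2 : ℝ) • h‖ ^ 2 := by
    intro v
    rw [hh, norm_sub_sq_real, norm_smul, inner_smul_right, real_inner_comm]
    norm_num
    ring
  refine ⟨h, hh, le_antisymm ?_ ?_⟩
  · refine iSup_le fun v => ENNReal.ofReal_le_ofReal ?_
    rw [key]
    nlinarith [sq_nonneg ‖T v - (1/2 : ℝ) • h‖]
  · rw [← ENNReal.ofReal_toReal hfin]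
    refine ENNReal.ofReal_le_ofReal ?_
    refine le_of_forall_pos_le_add fun ε hε => ?_
    obtain ⟨_, ⟨v, rfl⟩, hv⟩ := Metric.mem_closure_iff.mp hcl (√ε) (Real.sqrt_pos.mpr hε)
    have h1 := hb ((1/2 : ℝ) • v)
    rw [key, map_smul, ← smul_sub, norm_smul, mul_pow] at h1
    rw [dist_eq_norm, norm_sub_rev] at hv
    have h2 : ‖T v - h‖ ^ 2 ≤ ε := by
      rw [← Real.sq_sqrt hε.le]
      gcongr
    norm_num at h1
    nlinarith [sq_nonneg ‖T v - h‖]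

def C1KSub : Submodule ℝ (ℝ → ℝ) where
  carrier := {G | IsC1K G}
  zero_mem' := by
    refine ⟨contDiff_const, HasCompactSupport.zero, ?_⟩
    simp [tsupport]
  add_mem' := by
    rintro a b ⟨ha, ha2, ha3⟩ ⟨hb, hb2, hb3⟩
    exact ⟨ha.add hb, ha2.add hb2, (tsupport_add a b).trans (union_subset ha3 hb3)⟩
  smul_mem' := by
    rintro c a ⟨ha, ha2, ha3⟩
    exact ⟨contDiff_const.smul ha, ha2.smul_left (f := fun _ => c),
      (tsupport_smul_subset_right (fun _ => c) a).trans ha3⟩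

/-- If a measurable density `m : (0,∞) → [0,1]` has finite energy, then it admits a
generalized derivative `g`, and the energy equals `(1/4)∫₀^∞ g(r)²/σ(m(r)) dr`. -/
theorem stmt0 (m : ℝ → ℝ) (hmeas : Measurable m)
    (hm01 : ∀ r ∈ Set.Ioi (0:ℝ), m r ∈ Set.Icc (0:ℝ) 1)
    (hQ : energy m ≠ ⊤) :
    ∃ g : ℝ → ℝ, LocallyIntegrableOn g (Set.Ioi 0) ∧
      (∀ G : ℝ → ℝ, IsC1K G →
        ∫ r in Set.Ioi (0:ℝ), deriv G r * m r
          = - ∫ r in Set.Ioi (0:ℝ), G r * g r) ∧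
      IntegrableOn (fun r => (g r) ^ 2 / (m r * (1 - m r))) (Set.Ioi 0) ∧
      energy m
        = ENNReal.ofReal
            ((1/4) * ∫ r in Set.Ioi (0:ℝ), (g r) ^ 2 / (m r * (1 - m r))) := by
  classical
  let s : ℝ → ℝ := fun r => m r * (1 - m r)
  have hsm : Measurable s := hmeas.mul (measurable_const.sub hmeas)
  let μ : Measure ℝ := volume.restrict (Ioi (0:ℝ))
  have hmμ : ∀ᵐ r ∂μ, m r ∈ Icc (0:ℝ) 1 :=
    (ae_restrict_iff' measurableSet_Ioi).mpr (Eventually.of_forall hm01)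
  have hs0 : ∀ᵐ r ∂μ, 0 ≤ s r := by
    filter_upwards [hmμ] with r hr
    exact mul_nonneg hr.1 (by linarith [hr.2])
  have hs1 : ∀ᵐ r ∂μ, s r ≤ 1 := by
    filter_upwards [hmμ] with r hr
    simp only [s]
    nlinarith [hr.1, hr.2]
  let d : ℝ → ℝ≥0∞ := fun r => ENNReal.ofReal (s r)
  have hdm : Measurable d := hsm.ennreal_ofReal
  have hdt : ∀ᵐ r ∂μ, d r < ∞ := Eventually.of_forall fun r => ENNReal.ofReal_lt_top
  let ν : Measure ℝ := μ.withDensity d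
  have hνle : ν ≤ volume := by
    calc ν ≤ μ.withDensity 1 := by
          refine withDensity_mono ?_
          filter_upwards [hs1] with r hr
          simpa [d] using hr
      _ = μ := withDensity_one
      _ ≤ volume := Measure.restrict_le_self
  have integral_nu : ∀ f : ℝ → ℝ, ∫ r, f r ∂ν = ∫ r, s r * f r ∂μ := by
    intro f
    rw [integral_withDensity_eq_integral_toReal_smul hdm hdt]
    refine integral_congr_ae ?_
    filter_upwards [hs0] with r hr
    simp [d, ENNReal.toReal_ofReal hr]
  have integrable_nu : ∀ f : ℝ → ℝ, Integrable f ν → Integrable (fun r => s r * f r) μ := by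
    intro f hf
    refine ((integrable_withDensity_iff hdm hdt).mp hf).congr ?_
    filter_upwards [hs0] with r hr
    simp [d, ENNReal.toReal_ofReal hr, mul_comm]
  have hmem : ∀ G : C1KSub, MemLp G.1 2 ν := fun G =>
    (G.2.1.continuous.memLp_of_hasCompactSupport G.2.2.1 (μ := volume)).mono_measure hνle
  let T : C1KSub →ₗ[ℝ] Lp ℝ 2 ν :=
    { toFun := fun G => (hmem G).toLp G.1
      map_add' := fun a b => MemLp.toLp_add (hmem a) (hmem b)
      map_smul' := fun c a => MemLp.toLp_const_smul c (hmem a) }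
  have hTae : ∀ G : C1KSub, T G =ᵐ[ν] G.1 := fun G => (hmem G).coeFn_toLp
  have hdi : ∀ G : C1KSub, Integrable (fun r => deriv G.1 r * m r) μ := by
    intro G
    have h1 : Integrable (deriv G.1) μ :=
      ((G.2.1.continuous_deriv le_rfl).integrable_of_hasCompactSupport
        G.2.2.1.deriv).mono_measure Measure.restrict_le_self
    refine h1.mul_bdd (c := 1) hmeas.aestronglyMeasurable ?_
    filter_upwards [hmμ] with r hr
    rw [Real.norm_eq_abs, abs_of_nonneg hr.1]
    exact hr.2
  have hdiff : ∀ (G : C1KSub) (r : ℝ), DifferentiableAt ℝ G.1 r := fun G r =>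
    (G.2.1.differentiable one_ne_zero) r
  let l : C1KSub →ₗ[ℝ] ℝ :=
    { toFun := fun G => - ∫ r, deriv G.1 r * m r ∂μ
      map_add' := fun a b => by
        have : ∀ r, deriv (a + b).1 r * m r = deriv a.1 r * m r + deriv b.1 r * m r := by
          intro r
          have : (a + b).1 = a.1 + b.1 := rfl
          rw [this, deriv_add (hdiff a r) (hdiff b r), add_mul]
        simp only [this]
        rw [integral_add (hdi a) (hdi b), neg_add]
      map_smul' := fun c a => by
        have : ∀ r, deriv (c • a).1 r * m r = c * (deriv a.1 r * m r) := by
          intro r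
          have : (c • a).1 = c • a.1 := rfl
          rw [this, deriv_const_smul _ (hdiff a r), smul_eq_mul, mul_assoc]
        simp only [this]
        rw [integral_const_mul]
        simp }
  have hnorm : ∀ G : C1KSub, ‖T G‖ ^ 2 = ∫ r, s r * (G.1 r) ^ 2 ∂μ := by
    intro G
    rw [← real_inner_self_eq_norm_sq, L2.inner_def, ← integral_nu]
    refine integral_congr_ae ?_
    filter_upwards [hTae G] with r hr
    rw [hr]
    simp [sq]
  have hen : energy m = ⨆ v, ENNReal.ofReal (l v - ‖T v‖ ^ 2) := by
    have : ∀ v, l v - ‖T v‖ ^ 2 = energyExpr m v.1 := by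
      intro v
      rw [hnorm]
      rfl
    simp only [this]
    rfl
  rw [hen] at hQ
  obtain ⟨h, hh, hval⟩ := quad_aux T l hQ
  have hhsm : Measurable (h : ℝ → ℝ) := (Lp.stronglyMeasurable h).measurable
  have hh2 : Integrable (fun r => s r * (h r) ^ 2) μ := integrable_nu _ (Lp.memLp h).integrable_sq
  have hdivv : (fun r => (s r * h r) ^ 2 / (m r * (1 - m r))) = fun r => s r * (h r) ^ 2 := by
    funext r
    change (s r * h r) ^ 2 / s r = _
    by_cases h0 : s r = 0
    · simp [h0]
    · field_simp
  refine ⟨fun r => s r * h r, ?_, ?_, ?_, ?_⟩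
  · refine (locallyIntegrableOn_iff isOpen_Ioi.isLocallyClosed).mpr fun K hK hKc => ?_
    have hKμ : volume.restrict K ≤ μ := Measure.restrict_mono hK le_rfl
    have h1 : IntegrableOn (fun _ : ℝ => (1:ℝ)) K := integrableOn_const hKc.measure_lt_top.ne
    have h2 : IntegrableOn (fun r => s r * (h r) ^ 2) K := hh2.mono_measure hKμ
    refine Integrable.mono' (h1.add h2) (hsm.mul hhsm).aestronglyMeasurable ?_
    filter_upwards [ae_mono hKμ hs0, ae_mono hKμ hs1] with r hr0 hr1
    simp only [Pi.add_apply]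
    rw [Real.norm_eq_abs, abs_mul, abs_of_nonneg hr0, ← sq_abs (h r)]
    nlinarith [mul_nonneg hr0 (sq_nonneg (|h r| - 1)), mul_nonneg hr0 (sq_nonneg (|h r|))]
  · intro G hG
    have h1 := hh ⟨G, hG⟩
    change - ∫ r, deriv G r * m r ∂μ = _ at h1
    change ∫ r, deriv G r * m r ∂μ = - ∫ r, G r * (s r * h r) ∂μ
    rw [← neg_eq_iff_eq_neg, h1, L2.inner_def]
    have h2 : ∀ r, G r * (s r * h r) = s r * (G r * h r) := fun r => by ring
    simp only [h2]
    rw [← integral_nu]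
    refine integral_congr_ae ?_
    filter_upwards [hTae ⟨G, hG⟩] with r hr
    rw [hr]
    simp
  · rw [hdivv]
    exact hh2
  · rw [hdivv, hen, hval, ← real_inner_self_eq_norm_sq, L2.inner_def, integral_nu]
    congr 2
    refine integral_congr_ae (Eventually.of_forall fun r => ?_)
    simp [sq]
end
end

section
/- For every measurable m:(0,∞)→[0,1] with Q(m(r)dr) < ∞, there exists a sequence of smooth functions mₙ:(0,∞)→(0,1), each bounded away from 0 and 1 and with derivative mₙ' compactly supported in (0,∞), such that ∫₀^∞ G(r) mₙ(r) dr → ∫₀^∞ G(r) m(r) dr for every continuous compactly supported G:(0,∞)→ℝ, and Q(mₙ(r)dr) → Q(m(r)dr). -/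
open MeasureTheory Set Filter
open scoped ENNReal

noncomputable section

/-- Smooth cutoffs. -/
lemma exists_cutoff (a' a b : ℝ) (h1 : a' < a) (h2 : a ≤ b) :
    ∃ χ : ℝ → ℝ, ContDiff ℝ (⊤ : ℕ∞) χ ∧ (∀ x, 0 ≤ χ x) ∧ (∀ x, χ x ≤ 1) ∧
      (∀ x ∈ Set.Icc a b, χ x = 1) ∧ HasCompactSupport χ ∧ tsupport χ ⊆ Set.Ioi a' := by
  let f : ContDiffBump ((a + b) / 2) :=
    ⟨(b - a) / 2 + (a - a') / 4, (b - a) / 2 + (a - a') / 2, by linarith, by linarith⟩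
  refine ⟨f, f.contDiff, fun x => f.nonneg, fun x => f.le_one, ?_, f.hasCompactSupport, ?_⟩
  · intro x hx
    apply f.one_of_mem_closedBall
    rw [Real.closedBall_eq_Icc]
    constructor
    · change (a + b) / 2 - ((b - a) / 2 + (a - a') / 4) ≤ x
      linarith [hx.1]
    · change x ≤ (a + b) / 2 + ((b - a) / 2 + (a - a') / 4)
      linarith [hx.2]
  · rw [f.tsupport_eq, Real.closedBall_eq_Icc]
    intro x hx
    have := hx.1
    change (a + b) / 2 - ((b - a) / 2 + (a - a') / 2) ≤ x at this
    change a' < x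
    linarith

/-- Smooth monotone truncations of the half line. -/
lemma exists_trunc (n : ℕ) :
    ∃ φ : ℝ → ℝ, ContDiff ℝ (⊤ : ℕ∞) φ ∧ (∀ x, 0 ≤ deriv φ x) ∧ (∀ x, deriv φ x ≤ 1) ∧
      HasCompactSupport (deriv φ) ∧ tsupport (deriv φ) ⊆ Set.Ioi 0 ∧ 0 < φ 0 ∧
      (∀ x ∈ Set.Icc (1 / ((n : ℝ) + 1)) ((n : ℝ) + 1), φ x = x) := by
  have hn : (0 : ℝ) < (n : ℝ) + 1 := by positivity
  have hn1 : (1 : ℝ) ≤ (n : ℝ) + 1 := by linarith [Nat.cast_nonneg (α := ℝ) n]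
  have hinv : 0 < 1 / ((n : ℝ) + 1) := by positivity
  have hinv1 : 1 / ((n : ℝ) + 1) ≤ 1 := by rw [div_le_one hn]; exact hn1
  set α : ℝ := 1 / ((n : ℝ) + 1) with hα
  obtain ⟨χ, hχ, h0, h1, hone, hcs, hsup⟩ := exists_cutoff (α / 2) α ((n : ℝ) + 1)
    (by linarith) (by linarith)
  have hc : Continuous χ := hχ.continuous
  have hd : ∀ x, HasDerivAt (fun x => 1 + ∫ t in (1 : ℝ)..x, χ t) (χ x) x := fun x =>
    (intervalIntegral.integral_hasDerivAt_right (hc.intervalIntegrable _ _)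
      hc.stronglyMeasurable.stronglyMeasurableAtFilter hc.continuousAt).const_add 1
  have hde : deriv (fun x => 1 + ∫ t in (1 : ℝ)..x, χ t) = χ := funext fun x => (hd x).deriv
  have hz : ∀ x ≤ α / 2, χ x = 0 := fun x hx => by
    by_contra hne
    have := hsup (subset_tsupport _ hne)
    exact absurd this (not_lt.2 hx)
  refine ⟨fun x => 1 + ∫ t in (1 : ℝ)..x, χ t, ?_, ?_, ?_, ?_, ?_, ?_, ?_⟩
  · rw [contDiff_infty_iff_deriv, hde]
    exact ⟨fun x => (hd x).differentiableAt, hχ⟩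
  · rw [hde]; exact h0
  · rw [hde]; exact h1
  · rw [hde]; exact hcs
  · rw [hde]; exact hsup.trans (Ioi_subset_Ioi (by linarith))
  · change 0 < 1 + ∫ t in (1 : ℝ)..0, χ t
    have e1 : ∫ t in (0 : ℝ)..1, χ t = (∫ t in (0 : ℝ)..(α / 2), χ t) + ∫ t in (α / 2)..1, χ t :=
      (intervalIntegral.integral_add_adjacent_intervals (hc.intervalIntegrable _ _)
        (hc.intervalIntegrable _ _)).symm
    have e2 : ∫ t in (0 : ℝ)..(α / 2), χ t = 0 := by
      rw [intervalIntegral.integral_congr (g := fun _ => (0 : ℝ))]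
      · simp
      · intro t ht
        rw [uIcc_of_le (by linarith)] at ht
        exact hz t ht.2
    have e3 : ∫ t in (α / 2)..1, χ t ≤ ∫ t in (α / 2)..1, (1 : ℝ) :=
      intervalIntegral.integral_mono_on (by linarith) (hc.intervalIntegrable _ _)
        (by simp) (fun x _ => h1 x)
    simp at e3
    rw [intervalIntegral.integral_symm]
    linarith
  · intro x hx
    change 1 + ∫ t in (1 : ℝ)..x, χ t = x
    rw [intervalIntegral.integral_congr (g := fun _ => (1 : ℝ))]
    · simp
    · intro t ht
      apply hone
      have : uIcc 1 x ⊆ Icc α ((n : ℝ) + 1) := by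
        apply uIcc_subset_Icc _ hx
        exact ⟨hinv1, hn1⟩
      exact this ht

lemma c1k_deriv_cont {G : ℝ → ℝ} (hG : IsC1K G) : Continuous (deriv G) :=
  hG.1.continuous_deriv le_rfl

lemma c1k_hasDerivAt {G : ℝ → ℝ} (hG : IsC1K G) (x : ℝ) : HasDerivAt G (deriv G x) x :=
  (hG.1.differentiable (by norm_num) x).hasDerivAt

lemma c1k_sq_cs {G : ℝ → ℝ} (hG : IsC1K G) : HasCompactSupport (fun r => G r ^ 2) := by
  apply hG.2.1.comp_left (g := fun x : ℝ => x ^ 2); simp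

lemma c1k_integrable_bound {G : ℝ → ℝ} (hG : IsC1K G) :
    Integrable (fun r => |deriv G r| + G r ^ 2) := by
  refine Integrable.add ?_ ?_
  · exact ((c1k_deriv_cont hG).integrable_of_hasCompactSupport hG.2.1.deriv).abs
  · exact (hG.1.continuous.pow 2).integrable_of_hasCompactSupport (c1k_sq_cs hG)

lemma c1k_int1 {G m : ℝ → ℝ} (hG : IsC1K G) (hm : Measurable m) (h01 : ∀ r, m r ∈ Icc (0:ℝ) 1) :
    Integrable (fun r => deriv G r * m r) := by
  refine ((c1k_deriv_cont hG).integrable_of_hasCompactSupport hG.2.1.deriv).mul_bdd (c := 1)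
    hm.aestronglyMeasurable (Eventually.of_forall fun r => ?_)
  rw [Real.norm_eq_abs, abs_le]
  exact ⟨by linarith [(h01 r).1], (h01 r).2⟩

lemma c1k_int2 {G m : ℝ → ℝ} (hG : IsC1K G) (hm : Measurable m) (h01 : ∀ r, m r ∈ Icc (0:ℝ) 1) :
    Integrable (fun r => (m r * (1 - m r)) * G r ^ 2) := by
  refine ((hG.1.continuous.pow 2).integrable_of_hasCompactSupport (c1k_sq_cs hG)).bdd_mul (c := 1)
    (by fun_prop) (Eventually.of_forall fun r => ?_)
  rw [Real.norm_eq_abs, abs_le]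
  obtain ⟨h1, h2⟩ := h01 r
  constructor <;> nlinarith

lemma energyExpr_eq {G m : ℝ → ℝ} (hG : IsC1K G) (hm : Measurable m)
    (h01 : ∀ r, m r ∈ Icc (0:ℝ) 1) :
    energyExpr m G = ∫ r, (-(deriv G r * m r) - (m r * (1 - m r)) * G r ^ 2) := by
  have hz : ∀ r, r ∉ Ioi (0:ℝ) → G r = 0 := fun r hr => by
    by_contra h; exact hr (hG.2.2 (subset_tsupport _ h))
  have hz' : ∀ r, r ∉ Ioi (0:ℝ) → deriv G r = 0 := fun r hr => by
    by_contra h; exact hr (hG.2.2 (support_deriv_subset h))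
  unfold energyExpr
  rw [setIntegral_eq_integral_of_forall_compl_eq_zero (fun r hr => by rw [hz' r hr, zero_mul]),
    setIntegral_eq_integral_of_forall_compl_eq_zero (fun r hr => by rw [hz r hr]; simp),
    ← integral_neg]
  exact (integral_sub (c1k_int1 hG hm h01).neg (c1k_int2 hG hm h01)).symm

lemma energyExpr_integrable {G m : ℝ → ℝ} (hG : IsC1K G) (hm : Measurable m)
    (h01 : ∀ r, m r ∈ Icc (0:ℝ) 1) :
    Integrable (fun r => (-(deriv G r * m r) - (m r * (1 - m r)) * G r ^ 2)) :=
  (c1k_int1 hG hm h01).neg.sub (c1k_int2 hG hm h01)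

lemma c1k_shift {G : ℝ → ℝ} (hG : IsC1K G) {δ t : ℝ} (hs : tsupport G ⊆ Ioi δ) (ht : t < δ) :
    IsC1K (fun x => G (x + t)) := by
  refine ⟨hG.1.comp (contDiff_id.add contDiff_const), ?_, ?_⟩
  · exact hG.2.1.comp_homeomorph (Homeomorph.addRight t)
  · have : tsupport (fun x => G (x + t)) ⊆ (fun x => x + t) ⁻¹' tsupport G := by
      apply closure_minimal
      · intro x hx
        exact subset_tsupport _ hx
      · exact (isClosed_tsupport G).preimage (by fun_prop)
    intro x hx
    have h := hs (this hx)
    change δ < x + t at h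
    change 0 < x
    linarith

lemma moll_int {ρ M : ℝ → ℝ} (hρ : Integrable ρ) (hM : Measurable M)
    (h01 : ∀ r, M r ∈ Icc (0:ℝ) 1) (r : ℝ) : Integrable (fun t => ρ t * M (r - t)) := by
  refine hρ.mul_bdd (c := 1)
    (hM.comp (measurable_const.sub measurable_id)).aestronglyMeasurable (Eventually.of_forall fun t => ?_)
  rw [Real.norm_eq_abs, abs_le]
  exact ⟨by linarith [(h01 (r - t)).1], (h01 (r - t)).2⟩

lemma moll_mem {ρ M : ℝ → ℝ} (hρ : Integrable ρ) (hρ0 : ∀ t, 0 ≤ ρ t) (hρ1 : ∫ t, ρ t = 1)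
    (hM : Measurable M) (h01 : ∀ r, M r ∈ Icc (0:ℝ) 1) (r : ℝ) :
    ∫ t, ρ t * M (r - t) ∈ Icc (0:ℝ) 1 := by
  constructor
  · exact integral_nonneg fun t => mul_nonneg (hρ0 t) (h01 _).1
  · rw [← hρ1]
    exact integral_mono (moll_int hρ hM h01 r) hρ
      fun t => mul_le_of_le_one_right (hρ0 t) (h01 _).2

lemma moll_energy {ρ M v : ℝ → ℝ} {δ q : ℝ} (hρc : Continuous ρ) (hρ : Integrable ρ)
    (hρ0 : ∀ t, 0 ≤ ρ t) (hρ1 : ∫ t, ρ t = 1) (hsup : ∀ t, ρ t ≠ 0 → t < δ)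
    (hM : Measurable M) (h01 : ∀ r, M r ∈ Icc (0:ℝ) 1)
    (hq : ∀ G, IsC1K G → energyExpr M G ≤ q)
    (hv : ∀ r, v r = ∫ t, ρ t * M (r - t)) (hvc : Continuous v)
    {G : ℝ → ℝ} (hG : IsC1K G) (hs : tsupport G ⊆ Ioi δ) :
    energyExpr v G ≤ q := by
  have hGc := hG.1.continuous
  have hG'c := c1k_deriv_cont hG
  have hv01 : ∀ r, v r ∈ Icc (0:ℝ) 1 := fun r => by
    rw [hv]; exact moll_mem hρ hρ0 hρ1 hM h01 r
  let K : ℝ → ℝ → ℝ := fun r t =>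
    ρ t * (-(deriv G r * M (r - t)) - (M (r - t) * (1 - M (r - t))) * G r ^ 2)
  have hK : Integrable (Function.uncurry K) (volume.prod volume) := by
    refine Integrable.mono' ((c1k_integrable_bound hG).mul_prod hρ) ?_ ?_
    · apply Measurable.aestronglyMeasurable
      change Measurable fun p : ℝ × ℝ => ρ p.2 * (-(deriv G p.1 * M (p.1 - p.2)) -
        (M (p.1 - p.2) * (1 - M (p.1 - p.2))) * G p.1 ^ 2)
      fun_prop
    · refine Eventually.of_forall fun p => ?_
      change ‖ρ p.2 * (-(deriv G p.1 * M (p.1 - p.2)) -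
        (M (p.1 - p.2) * (1 - M (p.1 - p.2))) * G p.1 ^ 2)‖ ≤ (|deriv G p.1| + G p.1 ^ 2) * ρ p.2
      rw [Real.norm_eq_abs, abs_mul, abs_of_nonneg (hρ0 _), mul_comm]
      refine mul_le_mul_of_nonneg_right ?_ (hρ0 _)
      obtain ⟨h1, h2⟩ := h01 (p.1 - p.2)
      generalize M (p.1 - p.2) = y at *
      refine (abs_sub _ _).trans ?_
      rw [abs_neg, abs_mul, abs_mul, abs_of_nonneg h1,
        abs_of_nonneg (mul_nonneg h1 (by linarith : 0 ≤ 1 - y)), abs_of_nonneg (sq_nonneg (G p.1))]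
      refine add_le_add (mul_le_of_le_one_right (abs_nonneg _) h2) ?_
      exact mul_le_of_le_one_left (sq_nonneg _) (by nlinarith)
  have step1 : ∀ r, -(deriv G r * v r) - (v r * (1 - v r)) * G r ^ 2 ≤ ∫ t, K r t := by
    intro r
    have i1 := moll_int hρ hM h01 r
    have i2 : Integrable (fun t => ρ t * (M (r - t)) ^ 2) :=
      moll_int (M := fun x => M x ^ 2) hρ (by fun_prop) (fun x => by
        obtain ⟨h1, h2⟩ := h01 x
        constructor
        · positivity
        · change M x ^ 2 ≤ 1
          nlinarith) r
    have e : ∫ t, K r t = (-(deriv G r) - G r ^ 2) * v r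
        + G r ^ 2 * ∫ t, ρ t * (M (r - t)) ^ 2 := by
      rw [hv, ← integral_const_mul, ← integral_const_mul,
        ← integral_add (i1.const_mul _) (i2.const_mul _)]
      congr 1; ext t; simp only [K]; ring
    have cs : v r ^ 2 ≤ ∫ t, ρ t * (M (r - t)) ^ 2 := by
      have h0 : 0 ≤ ∫ t, ρ t * (M (r - t) - v r) ^ 2 :=
        integral_nonneg fun t => mul_nonneg (hρ0 t) (sq_nonneg _)
      have e2 : ∫ t, ρ t * (M (r - t) - v r) ^ 2 =
          (∫ t, ρ t * (M (r - t)) ^ 2) - 2 * v r * v r + v r ^ 2 * 1 := by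
        have a1 : Integrable (fun t => 2 * v r * (ρ t * M (r - t))) := i1.const_mul _
        have a2 : Integrable (fun t => v r ^ 2 * ρ t) := hρ.const_mul _
        have a3 : ∫ t, 2 * v r * (ρ t * M (r - t)) = 2 * v r * v r := by
          rw [integral_const_mul, ← hv]
        have a4 : ∫ t, v r ^ 2 * ρ t = v r ^ 2 * 1 := by
          rw [integral_const_mul, hρ1]
        rw [← a3, ← a4, ← integral_sub i2 a1]
        refine Eq.trans ?_ (integral_add (i2.sub a1) a2)
        congr 1; ext t; ring
      rw [e2] at h0
      linarith
    rw [e]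
    have := mul_le_mul_of_nonneg_left cs (sq_nonneg (G r))
    linarith
  have step2 : ∀ t, ∫ r, K r t ≤ ρ t * q := by
    intro t
    simp only [K]
    rw [integral_const_mul]
    by_cases h : ρ t = 0
    · simp [h]
    refine mul_le_mul_of_nonneg_left ?_ (hρ0 t)
    have hGt := c1k_shift hG hs (hsup t h)
    have := hq _ hGt
    rw [energyExpr_eq hGt hM h01] at this
    simp only [deriv_comp_add_const] at this
    rw [← integral_add_right_eq_self _ t]
    simpa using this
  rw [energyExpr_eq hG hvc.measurable hv01]
  calc _ ≤ ∫ r, ∫ t, K r t :=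
        integral_mono (energyExpr_integrable hG hvc.measurable hv01) hK.integral_prod_left step1
    _ = ∫ t, ∫ r, K r t := integral_integral_swap hK
    _ ≤ ∫ t, ρ t * q := integral_mono hK.integral_prod_right (hρ.mul_const q) step2
    _ = q := by rw [integral_mul_const, hρ1, one_mul]

lemma shrink_energy {v : ℝ → ℝ} {c q : ℝ} (hc0 : 0 ≤ c) (hc1 : c ≤ 1) (hq0 : 0 ≤ q)
    (hvc : Continuous v) (hv01 : ∀ r, v r ∈ Icc (0:ℝ) 1) {G : ℝ → ℝ} (hG : IsC1K G)
    (h : energyExpr v G ≤ q) :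
    energyExpr (fun r => (1 - c) * v r + c / 2) G ≤ q := by
  have hw01 : ∀ r, (1 - c) * v r + c / 2 ∈ Icc (0:ℝ) 1 := fun r => by
    obtain ⟨h1, h2⟩ := hv01 r
    constructor <;> nlinarith
  have hGi : Integrable (deriv G) :=
    (c1k_deriv_cont hG).integrable_of_hasCompactSupport hG.2.1.deriv
  have hz : ∫ r, deriv G r = 0 := integral_eq_zero_of_hasDerivAt_of_integrable
    (c1k_hasDerivAt hG) hGi (hG.1.continuous.integrable_of_hasCompactSupport hG.2.1)
  rw [energyExpr_eq hG hvc.measurable hv01] at h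
  have hi := energyExpr_integrable hG hvc.measurable hv01
  rw [energyExpr_eq hG (by fun_prop) hw01]
  calc _ ≤ ∫ r, ((1 - c) * (-(deriv G r * v r) - (v r * (1 - v r)) * G r ^ 2)
          - c / 2 * deriv G r) := by
        refine integral_mono (energyExpr_integrable hG (by fun_prop) hw01)
          ((hi.const_mul _).sub (hGi.const_mul _)) fun r => ?_
        obtain ⟨h1, h2⟩ := hv01 r
        have hkey : (1 - c) * (v r * (1 - v r)) ≤
            ((1 - c) * v r + c / 2) * (1 - ((1 - c) * v r + c / 2)) := by
          have : ((1 - c) * v r + c / 2) * (1 - ((1 - c) * v r + c / 2)) -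
            (1 - c) * (v r * (1 - v r)) = c * (1 - c) * (v r - 1/2) ^ 2 + c / 4 := by ring
          have h3 : 0 ≤ c * (1 - c) * (v r - 1/2) ^ 2 := by
            have : 0 ≤ 1 - c := by linarith
            positivity
          linarith
        have := mul_le_mul_of_nonneg_right hkey (sq_nonneg (G r))
        linarith
    _ = (1 - c) * (∫ r, (-(deriv G r * v r) - (v r * (1 - v r)) * G r ^ 2)) := by
        rw [integral_sub (hi.const_mul _) (hGi.const_mul _), integral_const_mul,
          integral_const_mul, hz]; ring
    _ ≤ q := by nlinarith

lemma energyExpr_parts {m G : ℝ → ℝ} (hG : IsC1K G) (hm : ContDiff ℝ 1 m)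
    (h01 : ∀ r, m r ∈ Icc (0:ℝ) 1) :
    Integrable (fun r => G r * deriv m r - (m r * (1 - m r)) * G r ^ 2) ∧
    energyExpr m G = ∫ r, (G r * deriv m r - (m r * (1 - m r)) * G r ^ 2) := by
  have hGc := hG.1.continuous
  have hG'c := c1k_deriv_cont hG
  have hmc := hm.continuous
  have hm'c : Continuous (deriv m) := hm.continuous_deriv le_rfl
  have i1 : Integrable (G * deriv m) :=
    (hGc.mul hm'c).integrable_of_hasCompactSupport hG.2.1.mul_right
  have i2 : Integrable (deriv G * m) := c1k_int1 hG hmc.measurable h01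
  have i3 : Integrable (G * m) :=
    (hGc.mul hmc).integrable_of_hasCompactSupport hG.2.1.mul_right
  have i4 := c1k_int2 hG hmc.measurable h01
  have hp : ∫ r, G r * deriv m r = - ∫ r, deriv G r * m r :=
    integral_mul_deriv_eq_deriv_mul_of_integrable (fun x _ => c1k_hasDerivAt hG x)
    (fun x _ => (hm.differentiable (by norm_num) x).hasDerivAt) i1 i2 i3
  refine ⟨i1.sub i4, ?_⟩
  have e1 : ∫ r, (G r * deriv m r - (m r * (1 - m r)) * G r ^ 2) = (∫ r, G r * deriv m r)
    - ∫ r, (m r * (1 - m r)) * G r ^ 2 := integral_sub i1 i4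
  have e2 : ∫ r, (-(deriv G r * m r) - (m r * (1 - m r)) * G r ^ 2) = (∫ r, -(deriv G r * m r))
    - ∫ r, (m r * (1 - m r)) * G r ^ 2 := integral_sub i2.neg i4
  rw [energyExpr_eq hG hmc.measurable h01, e1, e2, hp, integral_neg]

lemma smooth_energy_le {w : ℝ → ℝ} {ε δ q a b : ℝ} (hw : ContDiff ℝ (⊤ : ℕ∞) w) (hε : 0 < ε)
    (hb : ∀ r, ε ≤ w r ∧ w r ≤ 1 - ε) (hδ0 : 0 ≤ δ) (hδ : δ < a) (hab : a ≤ b)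
    (hq : ∀ G, IsC1K G → tsupport G ⊆ Ioi δ → energyExpr w G ≤ q) :
    ∫ x in a..b, (deriv w x) ^ 2 / (4 * (w x * (1 - w x))) ≤ q := by
  obtain ⟨χ, hχ, h0, h1, hone, hcs, hsup⟩ := exists_cutoff δ a b hδ hab
  have hw' : ContDiff ℝ (⊤ : ℕ∞) (deriv w) := (contDiff_infty_iff_deriv.1 hw).2
  have hσ : ∀ x, 0 < w x * (1 - w x) := fun x =>
    mul_pos (by linarith [(hb x).1]) (by linarith [(hb x).2])
  have h01 : ∀ r, w r ∈ Icc (0:ℝ) 1 := fun r => ⟨by linarith [(hb r).1], by linarith [(hb r).2]⟩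
  let G : ℝ → ℝ := fun x => χ x * (deriv w x / (2 * (w x * (1 - w x))))
  have hGs : tsupport G ⊆ tsupport χ := tsupport_mul_subset_left
  have hGC : ContDiff ℝ (⊤ : ℕ∞) G := by
    refine hχ.mul (hw'.div ?_ fun x => ?_)
    · exact contDiff_const.mul (hw.mul (contDiff_const.sub hw))
    · have := hσ x; positivity
  have hG : IsC1K G :=
    ⟨hGC.of_le (by exact_mod_cast le_top), hcs.mul_right,
      (hGs.trans hsup).trans (Ioi_subset_Ioi hδ0)⟩
  have hE := hq G hG (hGs.trans hsup)
  obtain ⟨hi, he⟩ := energyExpr_parts hG (hw.of_le (by exact_mod_cast le_top)) h01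
  rw [he] at hE
  refine le_trans ?_ hE
  rw [intervalIntegral.integral_of_le hab]
  have hid : ∀ x, G x * deriv w x - (w x * (1 - w x)) * G x ^ 2 =
      (2 * χ x - χ x ^ 2) * ((deriv w x) ^ 2 / (4 * (w x * (1 - w x)))) := by
    intro x
    have := (hσ x).ne'
    have hσx := hσ x
    simp only [G]
    generalize w x * (1 - w x) = s at *
    field_simp
    ring
  calc _ = ∫ x in Ioc a b, (G x * deriv w x - (w x * (1 - w x)) * G x ^ 2) := by
        refine setIntegral_congr_fun measurableSet_Ioc fun x hx => ?_
        simp only [hid]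
        rw [hone x ⟨hx.1.le, hx.2⟩]; ring
    _ ≤ _ := by
        refine setIntegral_le_integral hi (Eventually.of_forall fun x => ?_)
        simp only [hid, Pi.zero_apply]
        have := hσ x
        have h3 : 0 ≤ 2 * χ x - χ x ^ 2 := by nlinarith [h0 x, h1 x]
        positivity

lemma trunc_energy_le {w φ : ℝ → ℝ} {ε δ q : ℝ} (hw : ContDiff ℝ (⊤ : ℕ∞) w) (hε : 0 < ε)
    (hb : ∀ r, ε ≤ w r ∧ w r ≤ 1 - ε) (hδ0 : 0 ≤ δ)
    (hq : ∀ G, IsC1K G → tsupport G ⊆ Ioi δ → energyExpr w G ≤ q)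
    (hφ : ContDiff ℝ (⊤ : ℕ∞) φ) (hφ0 : ∀ x, 0 ≤ deriv φ x) (hφ1 : ∀ x, deriv φ x ≤ 1)
    (hcs : HasCompactSupport (deriv φ)) (hsup : tsupport (deriv φ) ⊆ Ioi 0) (hδ : δ < φ 0)
    {G : ℝ → ℝ} (hG : IsC1K G) :
    energyExpr (fun r => w (φ r)) G ≤ q := by
  have hσ : ∀ x, 0 < w x * (1 - w x) := fun x =>
    mul_pos (by linarith [(hb x).1]) (by linarith [(hb x).2])
  have h01 : ∀ r, w (φ r) ∈ Icc (0:ℝ) 1 :=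
    fun r => ⟨by linarith [(hb (φ r)).1], by linarith [(hb (φ r)).2]⟩
  have hφd : ∀ x, HasDerivAt φ (deriv φ x) x := fun x =>
    ((contDiff_infty_iff_deriv.1 hφ).1 x).hasDerivAt
  have hwd : ∀ x, HasDerivAt w (deriv w x) x := fun x =>
    ((contDiff_infty_iff_deriv.1 hw).1 x).hasDerivAt
  have hφ'c : Continuous (deriv φ) := (contDiff_infty_iff_deriv.1 hφ).2.continuous
  have hw'c : Continuous (deriv w) := (contDiff_infty_iff_deriv.1 hw).2.continuous
  have hd : ∀ x, deriv (fun r => w (φ r)) x = deriv w (φ x) * deriv φ x := fun x =>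
    ((hwd (φ x)).comp x (hφd x)).deriv
  have hmono : Monotone φ := monotone_of_deriv_nonneg (contDiff_infty_iff_deriv.1 hφ).1 hφ0
  obtain ⟨R, hR⟩ := hcs.isCompact.bddAbove
  let F : ℝ → ℝ := fun x => (deriv w x) ^ 2 / (4 * (w x * (1 - w x)))
  have hFc : Continuous F := by
    refine (hw'c.pow 2).div₀ ?_ fun x => ?_
    · exact continuous_const.mul (hw.continuous.mul (continuous_const.sub hw.continuous))
    · have := hσ x; positivity
  have hF0 : ∀ x, 0 ≤ F x := fun x => by
    have := hσ x
    simp only [F]; positivity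
  obtain ⟨hi, he⟩ := energyExpr_parts (m := fun r => w (φ r)) hG
    ((hw.comp hφ).of_le (by exact_mod_cast le_top) : ContDiff ℝ 1 (fun r => w (φ r))) h01
  rw [he]
  have hic : Integrable (fun x => F (φ x) * deriv φ x) :=
    ((hFc.comp hφ.continuous).mul hφ'c).integrable_of_hasCompactSupport hcs.mul_left
  calc _ ≤ ∫ x, F (φ x) * deriv φ x := by
        refine integral_mono hi hic fun x => ?_
        simp only [hd]
        have hs := hσ (φ x)
        have h2 : G x * (deriv w (φ x) * deriv φ x) - (w (φ x) * (1 - w (φ x))) * G x ^ 2 ≤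
            F (φ x) * deriv φ x ^ 2 := by
          simp only [F]
          generalize w (φ x) * (1 - w (φ x)) = s at *
          rw [div_mul_eq_mul_div, le_div_iff₀ (by positivity)]
          nlinarith [sq_nonneg (2 * s * G x - deriv w (φ x) * deriv φ x)]
        refine h2.trans (mul_le_mul_of_nonneg_left ?_ (hF0 _))
        nlinarith [hφ0 x, hφ1 x]
    _ = ∫ x in Ioc 0 (max R 0), F (φ x) * deriv φ x := by
        symm
        refine setIntegral_eq_integral_of_forall_compl_eq_zero fun x hx => ?_
        by_contra hne
        have hx' : x ∈ tsupport (deriv φ) := subset_tsupport _ (right_ne_zero_of_mul hne)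
        exact hx ⟨hsup hx', (hR hx').trans (le_max_left _ _)⟩
    _ = ∫ x in (0:ℝ)..(max R 0), (F ∘ φ) x * deriv φ x := by
        rw [intervalIntegral.integral_of_le (le_max_right _ _)]; rfl
    _ = ∫ x in (φ 0)..(φ (max R 0)), F x :=
        intervalIntegral.integral_comp_mul_deriv (fun x _ => hφd x) hφ'c.continuousOn hFc
    _ ≤ q := smooth_energy_le hw hε hb hδ0 hδ (hmono (le_max_right _ _)) hq

lemma energyExpr_tendsto {ms : ℕ → ℝ → ℝ} {m : ℝ → ℝ} (hms : ∀ n, Measurable (ms n))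
    (h01 : ∀ n r, ms n r ∈ Icc (0:ℝ) 1)
    (hae : ∀ᵐ r ∂(volume.restrict (Ioi (0:ℝ))), Tendsto (fun n => ms n r) atTop (nhds (m r)))
    {G : ℝ → ℝ} (hG : IsC1K G) :
    Tendsto (fun n => energyExpr (ms n) G) atTop (nhds (energyExpr m G)) := by
  have hGc := hG.1.continuous
  have hG'c := c1k_deriv_cont hG
  unfold energyExpr
  refine Tendsto.sub (Tendsto.neg ?_) ?_
  · refine tendsto_integral_of_dominated_convergence (fun r => |deriv G r| + G r ^ 2)
      (fun n => ?_) (c1k_integrable_bound hG).integrableOn (fun n => Eventually.of_forall fun r => ?_) ?_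
    · have := hms n
      exact (hG'c.measurable.mul this).aestronglyMeasurable
    · obtain ⟨h1, h2⟩ := h01 n r
      rw [Real.norm_eq_abs, abs_mul, abs_of_nonneg h1]
      nlinarith [abs_nonneg (deriv G r), sq_nonneg (G r)]
    · filter_upwards [hae] with r hr
      exact hr.const_mul _
  · refine tendsto_integral_of_dominated_convergence (fun r => |deriv G r| + G r ^ 2)
      (fun n => ?_) (c1k_integrable_bound hG).integrableOn (fun n => Eventually.of_forall fun r => ?_) ?_
    · have := hms n
      exact ((this.mul (measurable_const.sub this)).mul
        (hGc.measurable.pow_const 2)).aestronglyMeasurable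
    · obtain ⟨h1, h2⟩ := h01 n r
      have h3 : 0 ≤ ms n r * (1 - ms n r) := mul_nonneg h1 (by linarith)
      rw [Real.norm_eq_abs, abs_of_nonneg (mul_nonneg h3 (sq_nonneg _))]
      have h4 : ms n r * (1 - ms n r) ≤ 1 := by nlinarith
      nlinarith [abs_nonneg (deriv G r), sq_nonneg (G r)]
    · filter_upwards [hae] with r hr
      exact (hr.mul (hr.const_sub 1)).mul_const _

/-- Any density with finite energy can be approximated, in the vague topology and in
energy, by smooth densities bounded away from `0` and `1` whose derivative has compact
support in `(0,∞)`. -/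
theorem stmt5 (m : ℝ → ℝ) (hmeas : Measurable m)
    (hm01 : ∀ r ∈ Set.Ioi (0:ℝ), m r ∈ Set.Icc (0:ℝ) 1)
    (hQ : energy m ≠ ⊤) :
    ∃ ms : ℕ → ℝ → ℝ,
      (∀ n, ContDiff ℝ (⊤ : ℕ∞) (ms n)) ∧
      (∀ n, ∃ ε : ℝ, 0 < ε ∧ ∀ r, ε ≤ ms n r ∧ ms n r ≤ 1 - ε) ∧
      (∀ n, HasCompactSupport (deriv (ms n)) ∧ tsupport (deriv (ms n)) ⊆ Set.Ioi 0) ∧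
      (∀ G : ℝ → ℝ, Continuous G → HasCompactSupport G → tsupport G ⊆ Set.Ioi 0 →
        Tendsto (fun n => ∫ r in Set.Ioi (0:ℝ), G r * ms n r) atTop
          (nhds (∫ r in Set.Ioi (0:ℝ), G r * m r))) ∧
      Tendsto (fun n => energy (ms n)) atTop (nhds (energy m)) := by
  classical
  let M : ℝ → ℝ := fun r => max 0 (min 1 (m r))
  have hMm : Measurable M := measurable_const.max (measurable_const.min hmeas)
  have hM01 : ∀ r, M r ∈ Icc (0:ℝ) 1 := fun r =>
    ⟨le_max_left _ _, max_le zero_le_one (min_le_left _ _)⟩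
  have hMeq : ∀ r ∈ Ioi (0:ℝ), M r = m r := fun r hr => by
    simp only [M]
    rw [min_eq_right (hm01 r hr).2, max_eq_right (hm01 r hr).1]
  have hEM : ∀ G, energyExpr M G = energyExpr m G := fun G => by
    unfold energyExpr
    congr 1
    · congr 1
      exact setIntegral_congr_fun measurableSet_Ioi fun r hr => by simp only [hMeq r hr]
    · exact setIntegral_congr_fun measurableSet_Ioi fun r hr => by simp only [hMeq r hr]
  set q : ℝ := (energy m).toReal with hqdef
  have hq0 : 0 ≤ q := ENNReal.toReal_nonneg
  have hq : ∀ G, IsC1K G → energyExpr M G ≤ q := fun G hG => by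
    rw [hEM]
    have h1 : ENNReal.ofReal (energyExpr m G) ≤ energy m :=
      le_iSup (fun G : {G : ℝ → ℝ // IsC1K G} => ENNReal.ofReal (energyExpr m G.1)) ⟨G, hG⟩
    exact (ENNReal.ofReal_le_iff_le_toReal hQ).1 h1
  choose φ hφ hφ0 hφ1 hφcs hφsup hφpos hφid using exists_trunc
  let δ : ℕ → ℝ := fun n => min (φ n 0) (1 / ((n : ℝ) + 1)) / 2
  have hδpos : ∀ n, 0 < δ n := fun n =>
    half_pos (lt_min (hφpos n) (by positivity))
  have hδφ : ∀ n, δ n < φ n 0 := fun n =>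
    (half_lt_self (lt_min (hφpos n) (by positivity))).trans_le (min_le_left _ _)
  have hδle : ∀ n, δ n ≤ 1 / ((n : ℝ) + 1) := fun n =>
    (half_lt_self (lt_min (hφpos n) (by positivity))).le.trans (min_le_right _ _)
  have hδlim : Tendsto δ atTop (nhds 0) :=
    squeeze_zero (fun n => (hδpos n).le) hδle tendsto_one_div_add_atTop_nhds_zero_nat
  let B : ℕ → ContDiffBump (0 : ℝ) := fun n =>
    ⟨δ n / 2, δ n, half_pos (hδpos n), half_lt_self (hδpos n)⟩
  let v : ℕ → ℝ → ℝ := fun n =>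
    convolution ((B n).normed volume) M (ContinuousLinearMap.lsmul ℝ ℝ) volume
  have hMloc : LocallyIntegrable M volume := by
    refine (locallyIntegrable_const (1 : ℝ)).mono hMm.aestronglyMeasurable
      (Eventually.of_forall fun r => ?_)
    rw [Real.norm_eq_abs, abs_of_nonneg (hM01 r).1, norm_one]
    exact (hM01 r).2
  have hv : ∀ n r, v n r = ∫ t, (B n).normed volume t * M (r - t) := fun n r => rfl
  have hvC : ∀ n, ContDiff ℝ (⊤ : ℕ∞) (v n) := fun n =>
    (B n).hasCompactSupport_normed.contDiff_convolution_left _ (B n).contDiff_normed hMloc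
  have hv01 : ∀ n r, v n r ∈ Icc (0:ℝ) 1 := fun n r => by
    rw [hv]
    exact moll_mem (B n).integrable_normed (B n).nonneg_normed (B n).integral_normed hMm hM01 r
  have hvae : ∀ᵐ r, Tendsto (fun n => v n r) atTop (nhds (M r)) :=
    ContDiffBump.ae_convolution_tendsto_right_of_locallyIntegrable (φ := B) (K := 2) hδlim
      (Eventually.of_forall fun n => by
        change δ n ≤ 2 * (δ n / 2)
        linarith) hMloc
  let c : ℕ → ℝ := fun n => 1 / ((n : ℝ) + 1)
  have hc0 : ∀ n, 0 < c n := fun n => by simp only [c]; positivity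
  have hc1 : ∀ n, c n ≤ 1 := fun n => by
    simp only [c]
    rw [div_le_one (by positivity)]
    linarith [Nat.cast_nonneg (α := ℝ) n]
  have hclim : Tendsto c atTop (nhds 0) := tendsto_one_div_add_atTop_nhds_zero_nat
  let w : ℕ → ℝ → ℝ := fun n r => (1 - c n) * v n r + c n / 2
  have hwC : ∀ n, ContDiff ℝ (⊤ : ℕ∞) (w n) := fun n =>
    (contDiff_const.mul (hvC n)).add contDiff_const
  have hwb : ∀ n r, c n / 2 ≤ w n r ∧ w n r ≤ 1 - c n / 2 := fun n r => by
    obtain ⟨h1, h2⟩ := hv01 n r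
    have := hc0 n
    have := hc1 n
    simp only [w]
    constructor <;> nlinarith
  have hwq : ∀ n G, IsC1K G → tsupport G ⊆ Ioi (δ n) → energyExpr (w n) G ≤ q := by
    intro n G hG hs
    refine shrink_energy (hc0 n).le (hc1 n) hq0 (hvC n).continuous (hv01 n) hG ?_
    refine moll_energy (B n).continuous_normed (B n).integrable_normed (B n).nonneg_normed
      (B n).integral_normed (fun t ht => ?_) hMm hM01 hq (hv n) (hvC n).continuous hG hs
    have ht' : t ∈ Function.support ((B n).normed volume) := ht
    rw [(B n).support_normed_eq, Real.ball_eq_Ioo] at ht'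
    have := ht'.2
    change t < 0 + δ n at this
    linarith
  have hms01 : ∀ n r, w n (φ n r) ∈ Icc (0:ℝ) 1 := fun n r =>
    ⟨by linarith [(hwb n (φ n r)).1, hc0 n], by linarith [(hwb n (φ n r)).2, hc0 n]⟩
  have hmsC : ∀ n, ContDiff ℝ (⊤ : ℕ∞) (fun r => w n (φ n r)) := fun n => (hwC n).comp (hφ n)
  have hae : ∀ᵐ r ∂(volume.restrict (Ioi (0:ℝ))),
      Tendsto (fun n => w n (φ n r)) atTop (nhds (m r)) := by
    filter_upwards [ae_restrict_of_ae hvae, ae_restrict_mem measurableSet_Ioi] with r hr hr0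
    have h1 : Tendsto (fun n => w n r) atTop (nhds (m r)) := by
      have : Tendsto (fun n => w n r) atTop (nhds ((1 - 0) * M r + 0 / 2)) :=
        ((hclim.const_sub 1).mul hr).add (hclim.div_const 2)
      simpa [hMeq r hr0] using this
    refine h1.congr' ?_
    have e1 : ∀ᶠ n : ℕ in atTop, c n < r := hclim.eventually_lt_const hr0
    have e2 : ∀ᶠ n : ℕ in atTop, r ≤ (n : ℝ) :=
      tendsto_natCast_atTop_atTop.eventually_ge_atTop r
    filter_upwards [e1, e2] with n h1 h2
    rw [hφid n r ⟨h1.le, by linarith⟩]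
  refine ⟨fun n r => w n (φ n r), hmsC, fun n => ⟨c n / 2, half_pos (hc0 n), fun r => hwb n _⟩,
    fun n => ?_, fun G hG hGcs _ => ?_, ?_⟩
  · have hd : deriv (fun r => w n (φ n r)) = fun x => deriv (w n) (φ n x) * deriv (φ n) x :=
      funext fun x => (((contDiff_infty_iff_deriv.1 (hwC n)).1 (φ n x)).hasDerivAt.comp x
        ((contDiff_infty_iff_deriv.1 (hφ n)).1 x).hasDerivAt).deriv
    rw [hd]
    exact ⟨(hφcs n).mul_left, tsupport_mul_subset_right.trans (hφsup n)⟩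
  · refine tendsto_integral_of_dominated_convergence (fun r => |G r|) (fun n => ?_)
      (hG.integrable_of_hasCompactSupport hGcs).abs.integrableOn
      (fun n => Eventually.of_forall fun r => ?_) ?_
    · exact (hG.mul (hmsC n).continuous).aestronglyMeasurable
    · obtain ⟨h1, h2⟩ := hms01 n r
      rw [Real.norm_eq_abs, abs_mul, abs_of_nonneg h1]
      exact mul_le_of_le_one_right (abs_nonneg _) h2
    · filter_upwards [hae] with r hr
      exact hr.const_mul _
  · have hle : ∀ n, energy (fun r => w n (φ n r)) ≤ energy m := fun n => by
      refine iSup_le fun G => ?_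
      rw [ENNReal.ofReal_le_iff_le_toReal hQ]
      exact trunc_energy_le (hwC n) (half_pos (hc0 n)) (hwb n) (hδpos n).le (hwq n) (hφ n)
        (hφ0 n) (hφ1 n) (hφcs n) (hφsup n) (hδφ n) G.2
    refine tendsto_order.2 ⟨fun a ha => ?_, fun a ha => Eventually.of_forall fun n =>
      (hle n).trans_lt ha⟩
    obtain ⟨G, hGa⟩ := lt_iSup_iff.1 ha
    have ht := ENNReal.tendsto_ofReal (energyExpr_tendsto
      (fun n => (hmsC n).continuous.measurable) hms01 hae G.2)
    filter_upwards [ht.eventually_const_lt hGa] with n hn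
    exact hn.trans_le (le_iSup (fun G : {G : ℝ → ℝ // IsC1K G} =>
      ENNReal.ofReal (energyExpr (fun r => w n (φ n r)) G.1)) G)
end
end

section
/- Let J:(0,∞)→ℝ be a Lipschitz continuous function with compact support contained in [a,b] ⊂ (0,∞). There exists a finite constant C(J), depending only on J, such that for all 0 < δ ≤ a/2: limsup_{T→∞} sup_{x ∈ ℤ², |x| > T^{2δ}} | J(σ_T(x)) − (1/(4πδ log T)) Σ_{y ∈ 𝔸_{T,δ}(x)} |y|^{−2} J(σ_T(y)) | ≤ C(J) δ, where 𝔸_{T,δ}(x) = { y ∈ ℤ² : |x| T^{−δ} ≤ |y| ≤ |x| T^{δ} }. -/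
open MeasureTheory Set Filter
open scoped Classical

noncomputable section

/-- Square of the Euclidean norm of a point of `ℤ²`. -/
def nsq (x : ℤ × ℤ) : ℝ := ((x.1 : ℝ)) ^ 2 + ((x.2 : ℝ)) ^ 2

/-- Euclidean norm of a point of `ℤ²`. -/
def enorm2 (x : ℤ × ℤ) : ℝ := Real.sqrt (nsq x)

/-- `σ_T(x) = log |x| / log T`. -/
def sig (T : ℝ) (x : ℤ × ℤ) : ℝ := Real.log (enorm2 x) / Real.log T

/-- closed annulus in the plane -/
def annC (A B : ℝ) : Set ℂ := {z | A ≤ ‖z‖ ∧ ‖z‖ ≤ B}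

/-- the unit cell of a lattice point -/
def cell (y : ℤ × ℤ) : Set ℂ := {z | ⌊z.re + 1 / 2⌋ = y.1 ∧ ⌊z.im + 1 / 2⌋ = y.2}

lemma measurableSet_annC (A B : ℝ) : MeasurableSet (annC A B) :=
  ((isClosed_le continuous_const continuous_norm).inter
    (isClosed_le continuous_norm continuous_const)).measurableSet

lemma integrableOn_annC (A B : ℝ) (hA : 0 < A) :
    IntegrableOn (fun z : ℂ => 1 / ‖z‖ ^ 2) (annC A B) := by
  have hc : IsCompact (annC A B) := by
    refine (isCompact_closedBall (0 : ℂ) B).of_isClosed_subset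
      ((isClosed_le continuous_const continuous_norm).inter
        (isClosed_le continuous_norm continuous_const)) ?_
    intro z hz
    simpa using hz.2
  refine ContinuousOn.integrableOn_compact hc ?_
  refine continuousOn_const.div (by fun_prop) ?_
  intro z hz
  have : 0 < ‖z‖ := hA.trans_le hz.1
  positivity

lemma integral_annC (A B : ℝ) (hA : 0 < A) (hAB : A ≤ B) :
    ∫ z in annC A B, 1 / ‖z‖ ^ 2 = 2 * Real.pi * Real.log (B / A) := by
  rw [← integral_indicator (measurableSet_annC A B), ← Complex.integral_comp_polarCoord_symm]
  have h1 : ∫ p in polarCoord.target, p.1 • (annC A B).indicator (fun z : ℂ => 1 / ‖z‖ ^ 2)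
        (Complex.polarCoord.symm p)
      = ∫ p in Set.Ioi (0 : ℝ) ×ˢ Set.Ioo (-Real.pi) Real.pi,
        ((Set.Icc A B).indicator (fun r : ℝ => r⁻¹) p.1) * (fun _ : ℝ => (1 : ℝ)) p.2 := by
    refine setIntegral_congr_fun (measurableSet_Ioi.prod measurableSet_Ioo) ?_
    intro p hp
    have hp1 : 0 < p.1 := hp.1
    have hn : ‖Complex.polarCoord.symm p‖ = p.1 := by
      rw [Complex.norm_polarCoord_symm, abs_of_pos hp1]
    by_cases h : p.1 ∈ Set.Icc A B
    · have h' : Complex.polarCoord.symm p ∈ annC A B := by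
        simp only [annC, Set.mem_ofPred_eq, hn]; exact h
      simp only [Set.indicator_of_mem h', Set.indicator_of_mem h, hn, smul_eq_mul]
      field_simp
    · have h' : Complex.polarCoord.symm p ∉ annC A B := by
        simp only [annC, Set.mem_ofPred_eq, hn]; exact h
      simp only [Set.indicator_of_notMem h', Set.indicator_of_notMem h, smul_eq_mul]
      ring
  rw [h1, Measure.volume_eq_prod, setIntegral_prod_mul
    ((Set.Icc A B).indicator (fun r : ℝ => r⁻¹)) (fun _ : ℝ => (1 : ℝ)), setIntegral_indicator measurableSet_Icc]
  have h2 : Set.Ioi (0 : ℝ) ∩ Set.Icc A B = Set.Icc A B :=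
    Set.inter_eq_right.2 fun r hr => hA.trans_le hr.1
  rw [h2, integral_Icc_eq_integral_Ioc, ← intervalIntegral.integral_of_le hAB,
    integral_inv_of_pos hA (hA.trans_le hAB)]
  have : 0 ≤ Real.pi + Real.pi := by positivity
  simp [this]
  ring

lemma measurableSet_cell (y : ℤ × ℤ) : MeasurableSet (cell y) := by
  have h1 : Measurable fun z : ℂ => ⌊z.re + 1 / 2⌋ :=
    Int.measurable_floor.comp (Complex.measurable_re.add_const _)
  have h2 : Measurable fun z : ℂ => ⌊z.im + 1 / 2⌋ :=
    Int.measurable_floor.comp (Complex.measurable_im.add_const _)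
  exact (h1 (measurableSet_singleton y.1)).inter (h2 (measurableSet_singleton y.2))

lemma volume_cell (y : ℤ × ℤ) : volume (cell y) = 1 := by
  have h : cell y = Complex.measurableEquivRealProd ⁻¹'
      (Set.Ico ((y.1 : ℝ) - 1 / 2) (y.1 + 1 / 2) ×ˢ Set.Ico ((y.2 : ℝ) - 1 / 2) (y.2 + 1 / 2)) := by
    ext z
    simp only [cell, Set.mem_ofPred_eq, Int.floor_eq_iff, Set.mem_preimage, Set.mem_prod,
      Set.mem_Ico, Complex.measurableEquivRealProd_apply]
    constructor
    · rintro ⟨⟨_, _⟩, _, _⟩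
      refine ⟨⟨?_, ?_⟩, ?_, ?_⟩ <;> linarith
    · rintro ⟨⟨_, _⟩, _, _⟩
      refine ⟨⟨?_, ?_⟩, ?_, ?_⟩ <;> linarith
  rw [h, Complex.volume_preserving_equiv_real_prod.measure_preimage
    (measurableSet_Ico.prod measurableSet_Ico).nullMeasurableSet, Measure.volume_eq_prod,
    Measure.prod_prod, Real.volume_Ico, Real.volume_Ico, ← ENNReal.ofReal_mul (by norm_num)]
  norm_num

lemma enorm2_eq (y : ℤ × ℤ) : enorm2 y = ‖(⟨y.1, y.2⟩ : ℂ)‖ := by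
  rw [Complex.norm_eq_sqrt_sq_add_sq]; rfl

lemma enorm2_sq (y : ℤ × ℤ) : nsq y = enorm2 y ^ 2 := by
  rw [enorm2, Real.sq_sqrt]; unfold nsq; positivity

lemma cell_dist (y : ℤ × ℤ) (z : ℂ) (hz : z ∈ cell y) : |‖z‖ - enorm2 y| ≤ 1 := by
  rw [enorm2_eq]
  refine (abs_norm_sub_norm_le _ _).trans ?_
  obtain ⟨h1, h2⟩ := hz
  rw [Int.floor_eq_iff] at h1 h2
  refine (Complex.norm_le_abs_re_add_abs_im _).trans ?_
  have e1 : |(z - ⟨y.1, y.2⟩ : ℂ).re| ≤ 1 / 2 := by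
    rw [Complex.sub_re, abs_le]; constructor <;> simp only <;> linarith
  have e2 : |(z - ⟨y.1, y.2⟩ : ℂ).im| ≤ 1 / 2 := by
    rw [Complex.sub_im, abs_le]; constructor <;> simp only <;> linarith
  linarith

lemma cell_disj (S : Set (ℤ × ℤ)) : S.Pairwise (Function.onFun Disjoint cell) := by
  intro y _ y' _ hne
  refine Set.disjoint_left.2 fun z hz hz' => hne ?_
  exact Prod.ext (hz.1.symm.trans hz'.1) (hz.2.symm.trans hz'.2)

lemma cell_sub (R1 R2 : ℝ) (h1 : 2 ≤ R1) (y : ℤ × ℤ) (hy1 : R1 ≤ enorm2 y)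
    (hy2 : enorm2 y ≤ R2) : cell y ⊆ annC (R1 / 2) (2 * R2) := by
  intro z hz
  have := abs_le.1 (cell_dist y z hz)
  constructor <;> linarith [this.1, this.2]

lemma const_cell (y : ℤ × ℤ) (c : ℝ) : ∫ _z in cell y, c = c := by
  simp [Measure.real, volume_cell]

lemma sum_upper (R1 R2 : ℝ) (h1 : 2 ≤ R1) (h12 : R1 ≤ R2) (S : Finset (ℤ × ℤ))
    (hS : ∀ y ∈ S, R1 ≤ enorm2 y ∧ enorm2 y ≤ R2) :
    ∑ y ∈ S, 1 / nsq y ≤ (1 + 1 / R1) ^ 2 * (2 * Real.pi * Real.log (4 * (R2 / R1))) := by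
  have hint : ∀ y ∈ S, IntegrableOn (fun z : ℂ => (1 + 1 / R1) ^ 2 * (1 / ‖z‖ ^ 2)) (cell y) :=
    fun y hy => ((integrableOn_annC (R1 / 2) (2 * R2) (by linarith)).mono_set
      (cell_sub R1 R2 h1 y (hS y hy).1 (hS y hy).2)).const_mul _
  calc ∑ y ∈ S, 1 / nsq y
      ≤ ∑ y ∈ S, ∫ z in cell y, (1 + 1 / R1) ^ 2 * (1 / ‖z‖ ^ 2) := by
        refine Finset.sum_le_sum fun y hy => ?_
        rw [← const_cell y (1 / nsq y)]
        refine setIntegral_mono_on ?_ (hint y hy) (measurableSet_cell y) ?_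
        · exact integrableOn_const (by simp [volume_cell])
        intro z hz
        have hd := abs_le.1 (cell_dist y z hz)
        have hy1 := (hS y hy).1
        have hz0 : 0 < ‖z‖ := by linarith [hd.1]
        have hR : 0 < R1 := by linarith
        have hy0 : 0 < enorm2 y := by linarith
        rw [enorm2_sq, mul_one_div, div_le_div_iff₀ (by positivity) (by positivity), one_mul,
          ← mul_pow]
        refine pow_le_pow_left₀ hz0.le ?_ 2
        have : 1 ≤ 1 / R1 * enorm2 y := by
          rw [one_div_mul_eq_div, le_div_iff₀ hR]; linarith
        linarith [hd.2]
    _ = ∫ z in ⋃ y ∈ S, cell y, (1 + 1 / R1) ^ 2 * (1 / ‖z‖ ^ 2) :=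
        (integral_biUnion_finset S (fun y _ => measurableSet_cell y) (cell_disj _) hint).symm
    _ ≤ ∫ z in annC (R1 / 2) (2 * R2), (1 + 1 / R1) ^ 2 * (1 / ‖z‖ ^ 2) := by
        refine setIntegral_mono_set
          ((integrableOn_annC (R1 / 2) (2 * R2) (by linarith)).const_mul _) ?_ ?_
        · exact Filter.Eventually.of_forall fun z => by positivity
        · refine LE.le.eventuallyLE (Set.iUnion₂_subset fun y hy => ?_)
          exact cell_sub R1 R2 h1 y (hS y hy).1 (hS y hy).2
    _ = _ := by
        rw [integral_const_mul, integral_annC _ _ (by linarith) (by linarith)]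
        congr 3
        field_simp
        ring

lemma sum_lower (R1 R2 : ℝ) (h1 : 2 ≤ R1) (h12 : 4 * R1 ≤ R2) (S : Finset (ℤ × ℤ))
    (hS : ∀ y, y ∈ S ↔ R1 ≤ enorm2 y ∧ enorm2 y ≤ R2) :
    (1 - 1 / R1) ^ 2 * (2 * Real.pi * Real.log (R2 / R1 / 4)) ≤ ∑ y ∈ S, 1 / nsq y := by
  have hint : ∀ y ∈ S, IntegrableOn (fun z : ℂ => (1 - 1 / R1) ^ 2 * (1 / ‖z‖ ^ 2)) (cell y) :=
    fun y hy => ((integrableOn_annC (R1 / 2) (2 * R2) (by linarith)).mono_set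
      (cell_sub R1 R2 h1 y ((hS y).1 hy).1 ((hS y).1 hy).2)).const_mul _
  have hsub : (⋃ y ∈ S, cell y) ⊆ annC (R1 / 2) (2 * R2) :=
    Set.iUnion₂_subset fun y hy => cell_sub R1 R2 h1 y ((hS y).1 hy).1 ((hS y).1 hy).2
  calc (1 - 1 / R1) ^ 2 * (2 * Real.pi * Real.log (R2 / R1 / 4))
      = ∫ z in annC (2 * R1) (R2 / 2), (1 - 1 / R1) ^ 2 * (1 / ‖z‖ ^ 2) := by
        rw [integral_const_mul, integral_annC _ _ (by linarith) (by linarith)]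
        congr 3
        field_simp
        ring
    _ ≤ ∫ z in ⋃ y ∈ S, cell y, (1 - 1 / R1) ^ 2 * (1 / ‖z‖ ^ 2) := by
        refine setIntegral_mono_set
          (((integrableOn_annC (R1 / 2) (2 * R2) (by linarith)).mono_set hsub).const_mul _) ?_ ?_
        · exact Filter.Eventually.of_forall fun z => by positivity
        · refine LE.le.eventuallyLE fun z hz => ?_
          have hm : z ∈ cell (⌊z.re + 1 / 2⌋, ⌊z.im + 1 / 2⌋) := ⟨rfl, rfl⟩
          refine Set.mem_iUnion₂.2 ⟨_, ?_, hm⟩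
          have hd := abs_le.1 (cell_dist _ z hm)
          rw [hS]
          constructor <;> linarith [hd.1, hd.2, hz.1, hz.2]
    _ = ∑ y ∈ S, ∫ z in cell y, (1 - 1 / R1) ^ 2 * (1 / ‖z‖ ^ 2) :=
        integral_biUnion_finset S (fun y _ => measurableSet_cell y) (cell_disj _) hint
    _ ≤ _ := by
        refine Finset.sum_le_sum fun y hy => ?_
        rw [← const_cell y (1 / nsq y)]
        refine setIntegral_mono_on (hint y hy) ?_ (measurableSet_cell y) ?_
        · exact integrableOn_const (by simp [volume_cell])
        intro z hz
        have hd := abs_le.1 (cell_dist y z hz)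
        have hy1 := ((hS y).1 hy).1
        have hz0 : 0 < ‖z‖ := by linarith [hd.1]
        have hR : 0 < R1 := by linarith
        have hy0 : 0 < enorm2 y := by linarith
        rw [enorm2_sq, mul_one_div, div_le_div_iff₀ (by positivity) (by positivity), one_mul,
          ← mul_pow]
        have h3 : 1 / R1 ≤ 1 := by rw [div_le_one hR]; linarith
        refine pow_le_pow_left₀ (mul_nonneg (by linarith) hy0.le) ?_ 2
        have : 1 ≤ 1 / R1 * enorm2 y := by
          rw [one_div_mul_eq_div, le_div_iff₀ hR]; linarith
        linarith [hd.1]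

lemma finite_enorm2 (R : ℝ) : {y : ℤ × ℤ | enorm2 y ≤ R}.Finite := by
  refine ((Set.finite_Icc (-⌈R⌉) ⌈R⌉).prod (Set.finite_Icc (-⌈R⌉) ⌈R⌉)).subset ?_
  intro y hy
  have hy : enorm2 y ≤ R := hy
  rw [enorm2_eq] at hy
  have h1 := abs_le.1 ((Complex.abs_re_le_norm _).trans hy)
  have h2 := abs_le.1 ((Complex.abs_im_le_norm _).trans hy)
  simp only at h1 h2
  have hc := Int.le_ceil R
  simp only [Set.mem_prod, Set.mem_Icc]
  refine ⟨⟨?_, ?_⟩, ?_, ?_⟩ <;> (rify; linarith [h1.1, h1.2, h2.1, h2.2])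

/-- the normalized weight of the annulus tends to one -/
lemma weight_close (δ : ℝ) (hδ : 0 < δ) (η : ℝ) (hη : 0 < η) :
    ∃ T₀ : ℝ, 1 < T₀ ∧ ∀ T : ℝ, T₀ ≤ T → ∀ r : ℝ, T ^ (2 * δ) < r → ∀ S : Finset (ℤ × ℤ),
      (∀ y, y ∈ S ↔ r * T ^ (-δ) ≤ enorm2 y ∧ enorm2 y ≤ r * T ^ δ) →
      |1 - (1 / (4 * Real.pi * δ * Real.log T)) * ∑ y ∈ S, 1 / nsq y| ≤ η := by
  have hlog : Tendsto (fun T : ℝ => Real.log 4 / (2 * δ * Real.log T)) atTop (nhds 0) :=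
    (Real.tendsto_log_atTop.const_mul_atTop (by positivity)).const_div_atTop _
  have hpow : Tendsto (fun T : ℝ => T ^ (-δ)) atTop (nhds 0) := tendsto_rpow_neg_atTop hδ
  have hup : Tendsto (fun T : ℝ => (1 + T ^ (-δ)) ^ 2 * (1 + Real.log 4 / (2 * δ * Real.log T)))
      atTop (nhds 1) := by
    simpa using ((hpow.const_add 1).pow 2).mul (hlog.const_add 1)
  have hlo : Tendsto (fun T : ℝ => (1 - T ^ (-δ)) ^ 2 * (1 - Real.log 4 / (2 * δ * Real.log T)))
      atTop (nhds 1) := by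
    simpa using ((hpow.const_sub 1).pow 2).mul (hlog.const_sub 1)
  have ev := ((hup.eventually (gt_mem_nhds (show (1 : ℝ) < 1 + η by linarith))).and
    (hlo.eventually (lt_mem_nhds (show 1 - η < (1 : ℝ) by linarith)))).and
    ((tendsto_rpow_atTop hδ).eventually_ge_atTop 2)
  obtain ⟨T₁, hT₁⟩ := eventually_atTop.1 ev
  refine ⟨max T₁ 2, lt_of_lt_of_le (by norm_num) (le_max_right _ _), ?_⟩
  intro T hT r hr S hS
  obtain ⟨⟨hU, hL⟩, h2⟩ := hT₁ T ((le_max_left _ _).trans hT)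
  have hT2 : 2 ≤ T := (le_max_right _ _).trans hT
  have hT0 : 0 < T := by linarith
  have hlT : 0 < Real.log T := Real.log_pos (by linarith)
  have hpos : 0 < T ^ δ := by positivity
  have hinv : T ^ (-δ) = (T ^ δ)⁻¹ := Real.rpow_neg hT0.le δ
  have hdbl : T ^ (2 * δ) = T ^ δ * T ^ δ := by rw [two_mul, Real.rpow_add hT0]
  have hr0 : 0 < r := lt_trans (by positivity) hr
  have hR1 : T ^ δ ≤ r * T ^ (-δ) := by
    rw [hinv, ← div_eq_mul_inv, le_div_iff₀ hpos, ← hdbl]; exact hr.le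
  have hratio : r * T ^ δ / (r * T ^ (-δ)) = T ^ (2 * δ) := by
    rw [hinv, hdbl]; field_simp
  have hlogr : Real.log (r * T ^ δ / (r * T ^ (-δ))) = 2 * δ * Real.log T := by
    rw [hratio, Real.log_rpow hT0]
  have hRpos : 0 < r * T ^ (-δ) := by positivity
  have h4 : 4 * (r * T ^ (-δ)) ≤ r * T ^ δ := by
    rw [← le_div_iff₀ hRpos, hratio, hdbl]; nlinarith
  have hR12 : 1 / (r * T ^ (-δ)) ≤ T ^ (-δ) := by
    have h := one_div_le_one_div_of_le hpos hR1
    rwa [one_div (T ^ δ), ← hinv] at h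
  have hR1' : 0 < 1 / (r * T ^ (-δ)) := by positivity
  have hsm : T ^ (-δ) ≤ 1 := by
    rw [hinv]; exact inv_le_one_of_one_le₀ (by linarith)
  have up := sum_upper (r * T ^ (-δ)) (r * T ^ δ) (h2.trans hR1) (by linarith) S
    (fun y hy => (hS y).1 hy)
  have lo := sum_lower (r * T ^ (-δ)) (r * T ^ δ) (h2.trans hR1) h4 S hS
  have hrne : r * T ^ δ / (r * T ^ (-δ)) ≠ 0 := by rw [hratio]; positivity
  rw [Real.log_mul (by norm_num) hrne, hlogr] at up
  rw [Real.log_div hrne (by norm_num), hlogr] at lo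
  have hl4 : 0 < Real.log 4 := Real.log_pos (by norm_num)
  have hl4' : Real.log 4 ≤ 2 * δ * Real.log T := by
    rw [← hlogr]
    refine Real.log_le_log (by norm_num) ?_
    rw [le_div_iff₀ hRpos]; exact h4
  have hD : 0 < 4 * Real.pi * δ * Real.log T := by positivity
  have up2 : (1 / (4 * Real.pi * δ * Real.log T)) * ∑ y ∈ S, 1 / nsq y
      ≤ (1 + T ^ (-δ)) ^ 2 * (1 + Real.log 4 / (2 * δ * Real.log T)) := by
    rw [one_div_mul_eq_div, div_le_iff₀ hD]
    have e : (1 + T ^ (-δ)) ^ 2 * (1 + Real.log 4 / (2 * δ * Real.log T))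
        * (4 * Real.pi * δ * Real.log T)
        = (1 + T ^ (-δ)) ^ 2 * (2 * Real.pi * (Real.log 4 + 2 * δ * Real.log T)) := by
      field_simp; ring
    rw [e]
    refine up.trans ?_
    gcongr
  have lo2 : (1 - T ^ (-δ)) ^ 2 * (1 - Real.log 4 / (2 * δ * Real.log T))
      ≤ (1 / (4 * Real.pi * δ * Real.log T)) * ∑ y ∈ S, 1 / nsq y := by
    rw [one_div_mul_eq_div, le_div_iff₀ hD]
    have e : (1 - T ^ (-δ)) ^ 2 * (1 - Real.log 4 / (2 * δ * Real.log T))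
        * (4 * Real.pi * δ * Real.log T)
        = (1 - T ^ (-δ)) ^ 2 * (2 * Real.pi * (2 * δ * Real.log T - Real.log 4)) := by
      field_simp; ring
    rw [e]
    refine le_trans ?_ lo
    refine mul_le_mul_of_nonneg_right (pow_le_pow_left₀ (by linarith) (by linarith) 2) ?_
    have := sub_nonneg.2 hl4'
    positivity
  rw [abs_le]
  constructor <;> linarith

/-- Replacement of `J(σ_T(x))` by its weighted average over the annulus
`𝔸_{T,δ}(x) = {y : |x|T^{-δ} ≤ |y| ≤ |x|T^{δ}}`: the error is of order `δ`, uniformly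
over `|x| > T^{2δ}`, as `T → ∞`. The `limsup sup ≤ C(J)δ` statement is formulated
with an arbitrary `ε > 0`. -/
theorem stmt11 (a b : ℝ) (ha : 0 < a) (hab : a ≤ b)
    (J : ℝ → ℝ) (K : NNReal) (hLip : LipschitzWith K J)
    (hsupp : tsupport J ⊆ Set.Icc a b) :
    ∃ C : ℝ, ∀ δ : ℝ, 0 < δ → δ ≤ a / 2 →
      ∀ ε : ℝ, 0 < ε → ∃ T₀ : ℝ, ∀ T : ℝ, T₀ ≤ T →
        ∀ x : ℤ × ℤ, T ^ (2 * δ) < enorm2 x →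
          |J (sig T x)
            - (1 / (4 * Real.pi * δ * Real.log T)) *
                (∑' y : ℤ × ℤ,
                  if y ≠ 0 ∧ enorm2 x * T ^ (-δ) ≤ enorm2 y ∧
                      enorm2 y ≤ enorm2 x * T ^ δ
                  then J (sig T y) / nsq y else 0)|
            ≤ C * δ + ε := by
  obtain ⟨M, hM⟩ : ∃ M : ℝ, ∀ s, |J s| ≤ M := by
    have hcs : HasCompactSupport J := isCompact_Icc.of_isClosed_subset (isClosed_tsupport J) hsupp
    obtain ⟨M, hM⟩ := hcs.exists_bound_of_continuous hLip.continuous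
    exact ⟨M, fun s => by simpa using hM s⟩
  have hM0 : 0 ≤ M := (abs_nonneg _).trans (hM 0)
  have hK0 : (0 : ℝ) ≤ K := K.2
  refine ⟨K, fun δ hδ _ ε hε => ?_⟩
  have hden : 0 < M + K * δ + 1 := by positivity
  obtain ⟨T₀, hT₀, hw⟩ := weight_close δ hδ (ε / (M + K * δ + 1)) (by positivity)
  refine ⟨T₀, fun T hT x hx => ?_⟩
  have hT1 : 1 < T := hT₀.trans_le hT
  have hT0 : 0 < T := by linarith
  have hlT : 0 < Real.log T := Real.log_pos hT1
  have hx0 : 0 < enorm2 x := lt_trans (by positivity) hx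
  have hfin : {y : ℤ × ℤ | enorm2 x * T ^ (-δ) ≤ enorm2 y ∧ enorm2 y ≤ enorm2 x * T ^ δ}.Finite :=
    (finite_enorm2 (enorm2 x * T ^ δ)).subset fun y hy => hy.2
  set S := hfin.toFinset with hSdef
  have hS : ∀ y, y ∈ S ↔ enorm2 x * T ^ (-δ) ≤ enorm2 y ∧ enorm2 y ≤ enorm2 x * T ^ δ := by
    intro y; simp [hSdef]
  have hlow : 0 < enorm2 x * T ^ (-δ) := by positivity
  have hypos : ∀ y ∈ S, 0 < enorm2 y := fun y hy => hlow.trans_le ((hS y).1 hy).1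
  have hsum : (∑' y : ℤ × ℤ,
      if y ≠ 0 ∧ enorm2 x * T ^ (-δ) ≤ enorm2 y ∧ enorm2 y ≤ enorm2 x * T ^ δ
      then J (sig T y) / nsq y else 0) = ∑ y ∈ S, J (sig T y) / nsq y := by
    rw [tsum_eq_sum (s := S)]
    · refine Finset.sum_congr rfl fun y hy => ?_
      rw [if_pos]
      refine ⟨?_, (hS y).1 hy⟩
      rintro rfl
      have := hypos 0 hy
      simp [enorm2, nsq] at this
    · intro y hy
      rw [if_neg]
      exact fun h => hy ((hS y).2 h.2)
  rw [hsum]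
  have hW := hw T hT (enorm2 x) hx S hS
  set c := 1 / (4 * Real.pi * δ * Real.log T) with hc
  have hc0 : 0 ≤ c := by positivity
  set W := ∑ y ∈ S, 1 / nsq y with hWdef
  have hdiff : ∀ y ∈ S, |J (sig T x) - J (sig T y)| ≤ K * δ := by
    intro y hy
    have h1 := hLip.dist_le_mul (sig T x) (sig T y)
    rw [Real.dist_eq, Real.dist_eq] at h1
    refine h1.trans (mul_le_mul_of_nonneg_left ?_ hK0)
    unfold sig
    rw [← sub_div, abs_div, abs_of_pos hlT, div_le_iff₀ hlT, abs_le]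
    have l1 := Real.log_le_log hlow ((hS y).1 hy).1
    have l2 := Real.log_le_log (hypos y hy) ((hS y).1 hy).2
    rw [Real.log_mul hx0.ne' (by positivity), Real.log_rpow hT0] at l1 l2
    constructor <;> linarith
  have hsplit : J (sig T x) - c * ∑ y ∈ S, J (sig T y) / nsq y
      = J (sig T x) * (1 - c * W) + c * ∑ y ∈ S, (J (sig T x) - J (sig T y)) * (1 / nsq y) := by
    have : ∑ y ∈ S, (J (sig T x) - J (sig T y)) * (1 / nsq y)
        = J (sig T x) * W - ∑ y ∈ S, J (sig T y) / nsq y := by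
      rw [hWdef, Finset.mul_sum, ← Finset.sum_sub_distrib]
      exact Finset.sum_congr rfl fun y _ => by ring
    rw [this]; ring
  have hsecond : |∑ y ∈ S, (J (sig T x) - J (sig T y)) * (1 / nsq y)| ≤ K * δ * W := by
    refine (Finset.abs_sum_le_sum_abs _ _).trans ?_
    rw [hWdef, Finset.mul_sum]
    refine Finset.sum_le_sum fun y hy => ?_
    have : 0 ≤ 1 / nsq y := by rw [enorm2_sq]; positivity
    rw [abs_mul, abs_of_nonneg this]
    exact mul_le_mul_of_nonneg_right (hdiff y hy) this
  rw [hsplit]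
  set η := ε / (M + K * δ + 1) with hη
  have hη0 : 0 < η := by positivity
  have hηε : (M + K * δ + 1) * η = ε := by rw [hη]; field_simp
  have hcW : c * W ≤ 1 + η := by linarith [(abs_le.1 hW).1]
  calc _ ≤ |J (sig T x) * (1 - c * W)|
        + |c * ∑ y ∈ S, (J (sig T x) - J (sig T y)) * (1 / nsq y)| := abs_add_le _ _
    _ ≤ M * η + c * (K * δ * W) := by
        rw [abs_mul, abs_mul, abs_of_nonneg hc0]
        exact add_le_add (mul_le_mul (hM _) hW (abs_nonneg _) hM0)
          (mul_le_mul_of_nonneg_left hsecond hc0)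
    _ = M * η + K * δ * (c * W) := by ring
    _ ≤ M * η + K * δ * (1 + η) := by gcongr
    _ ≤ K * δ + ε := by nlinarith
end
end

section
/- Let 0 < a < b < ∞ and let H:ℝ₊→ℝ be twice continuously differentiable with compact support contained in [a,b]. There exists a finite constant C₀, depending only on H, such that for every T ≥ 2 and every configuration η ∈ {0,1}^{ℤ²}: | Σ_{j=1,2} Σ_{x ∈ ℤ²∖{0}} (x_j/|x|²) H(σ_T(x)) [η(x+e_j) − η(x)] + 2π ∫₀^∞ H'(r) μ^{1,T}(η)(dr) | ≤ C₀ T^{−a}. Equivalently, the first sum equals −(1/log T) Σ_{x ∈ ℤ²∖{0}} η(x) H'(σ_T(x)) |x|^{−2} up to an error bounded by C₀ T^{−a}. -/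
open MeasureTheory Set Filter
open scoped Classical

noncomputable section

/-- Sup norm on `ℤ²`. -/
def supn (x : ℤ × ℤ) : ℕ := max x.1.natAbs x.2.natAbs

lemma supn_fst (x : ℤ × ℤ) : |(x.1 : ℝ)| ≤ supn x := by
  have h : x.1.natAbs ≤ supn x := le_max_left _ _
  have : ((x.1.natAbs : ℕ) : ℝ) = |(x.1 : ℝ)| := by rw [Nat.cast_natAbs, Int.cast_abs]
  rw [← this]; exact_mod_cast h

lemma supn_snd (x : ℤ × ℤ) : |(x.2 : ℝ)| ≤ supn x := by
  have h : x.2.natAbs ≤ supn x := le_max_right _ _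
  have : ((x.2.natAbs : ℕ) : ℝ) = |(x.2 : ℝ)| := by rw [Nat.cast_natAbs, Int.cast_abs]
  rw [← this]; exact_mod_cast h

lemma supn_or (x : ℤ × ℤ) : (supn x : ℝ) = |(x.1 : ℝ)| ∨ (supn x : ℝ) = |(x.2 : ℝ)| := by
  rw [← Int.cast_abs, ← Int.cast_abs, ← Nat.cast_natAbs, ← Nat.cast_natAbs]
  rcases max_choice x.1.natAbs x.2.natAbs with h | h
  · left; unfold supn; rw [h]
  · right; unfold supn; rw [h]

lemma supn_card (S : Finset (ℤ × ℤ)) (k : ℕ) :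
    ((S.filter (fun x => supn x = k)).card : ℝ) ≤ 8 * (k + 1) := by
  have hsub : S.filter (fun x => supn x = k) ⊆ Finset.box k := by
    intro x hx
    rw [Int.mem_box]
    exact (Finset.mem_filter.1 hx).2
  have h := Finset.card_le_card hsub
  have h2 : (Finset.box k : Finset (ℤ × ℤ)).card ≤ 8 * (k + 1) := by
    rcases Nat.eq_zero_or_pos k with h0 | h0
    · subst h0; simp
    · rw [Int.card_box h0.ne']; omega
  exact_mod_cast h.trans h2

lemma tele (R : ℝ) (hR : 0 < R) (N : ℕ) :
    ∑ k ∈ Finset.range N, (if R ≤ 2 * ((k : ℝ) + 1) then 1 / ((k : ℝ) + 1) ^ 2 else 0) ≤ 4 / R := by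
  have key : ∀ k ∈ Finset.range N,
      (if R ≤ 2 * ((k : ℝ) + 1) then 1 / ((k : ℝ) + 1) ^ 2 else 0) ≤
      min (2 / ((k : ℝ) + 1)) (4 / R) - min (2 / (((k + 1 : ℕ) : ℝ) + 1)) (4 / R) := by
    intro k _
    have hk : (0 : ℝ) ≤ k := Nat.cast_nonneg k
    have hmono : 2 / (((k + 1 : ℕ) : ℝ) + 1) ≤ 2 / ((k : ℝ) + 1) := by
      push_cast
      gcongr
      linarith
    split_ifs with h
    · have h1 : 2 / ((k : ℝ) + 1) ≤ 4 / R := by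
        rw [div_le_div_iff₀ (by positivity) hR]; linarith
      rw [min_eq_left h1, min_eq_left (hmono.trans h1)]
      push_cast
      have : 2 / ((k : ℝ) + 1) - 2 / ((k : ℝ) + 1 + 1) = 2 / (((k : ℝ) + 1) * (k + 1 + 1)) := by
        field_simp; ring
      rw [this, div_le_div_iff₀ (by positivity) (by positivity)]
      nlinarith
    · have := min_le_min_right (4 / R) hmono
      linarith
  refine (Finset.sum_le_sum key).trans ?_
  rw [Finset.sum_range_sub' (fun k : ℕ => min (2 / ((k : ℝ) + 1)) (4 / R))]
  have h1 : min (2 / (((0 : ℕ) : ℝ) + 1)) (4 / R) ≤ 4 / R := min_le_right _ _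
  have h2 : 0 ≤ min (2 / ((N : ℝ) + 1)) (4 / R) := by positivity
  linarith

lemma tail (E : ℤ × ℤ → ℝ) (K R : ℝ) (hK : 0 ≤ K) (hR : 0 < R)
    (hE : ∀ x, |E x| ≤ K / ((supn x : ℝ) + 1) ^ 3)
    (hE0 : ∀ x, E x ≠ 0 → R ≤ 2 * ((supn x : ℝ) + 1)) (S : Finset (ℤ × ℤ)) :
    ∑ x ∈ S, |E x| ≤ 32 * K / R := by
  have hmaps : ∀ x ∈ S, supn x ∈ Finset.range (S.sup supn + 1) := by
    intro x hx
    exact Finset.mem_range.2 (Nat.lt_succ_of_le (Finset.le_sup (f := supn) hx))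
  rw [← Finset.sum_fiberwise_of_maps_to hmaps]
  have : ∀ k ∈ Finset.range (S.sup supn + 1), ∑ x ∈ S with supn x = k, |E x| ≤
      8 * K * (if R ≤ 2 * ((k : ℝ) + 1) then 1 / ((k : ℝ) + 1) ^ 2 else 0) := by
    intro k _
    split_ifs with h
    · have h1 : ∀ x ∈ S.filter (fun x => supn x = k), |E x| ≤ K / ((k : ℝ) + 1) ^ 3 := by
        intro x hx
        have := hE x
        rwa [(Finset.mem_filter.1 hx).2] at this
      refine (Finset.sum_le_card_nsmul _ _ _ h1).trans ?_
      rw [nsmul_eq_mul]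
      have hk : (0 : ℝ) ≤ k := Nat.cast_nonneg k
      calc _ ≤ 8 * ((k : ℝ) + 1) * (K / ((k : ℝ) + 1) ^ 3) := by
            gcongr
            exact supn_card S k
        _ = _ := by field_simp
    · rw [mul_zero]
      apply le_of_eq
      apply Finset.sum_eq_zero
      intro x hx
      by_contra hne
      apply h
      have := hE0 x (fun h0 => hne (by rw [h0, abs_zero]))
      rwa [(Finset.mem_filter.1 hx).2] at this
  refine (Finset.sum_le_sum this).trans ?_
  rw [← Finset.mul_sum]
  calc _ ≤ 8 * K * (4 / R) := by
        gcongr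
        exact tele R hR _
    _ = _ := by ring

/-- one-dimensional section of the vector field -/
def fsec (H : ℝ → ℝ) (L y t : ℝ) : ℝ := t / (t ^ 2 + y ^ 2) * H (L / 2 * Real.log (t ^ 2 + y ^ 2))

def fsec1 (H : ℝ → ℝ) (L y t : ℝ) : ℝ :=
  (1 / (t ^ 2 + y ^ 2) - 2 * (t / (t ^ 2 + y ^ 2)) ^ 2) * H (L / 2 * Real.log (t ^ 2 + y ^ 2))
  + L * (t / (t ^ 2 + y ^ 2)) ^ 2 * deriv H (L / 2 * Real.log (t ^ 2 + y ^ 2))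

def fsec2 (H : ℝ → ℝ) (L y t : ℝ) : ℝ :=
  (-6 * (t / (t ^ 2 + y ^ 2)) * (1 / (t ^ 2 + y ^ 2)) + 8 * (t / (t ^ 2 + y ^ 2)) ^ 3)
    * H (L / 2 * Real.log (t ^ 2 + y ^ 2))
  + 3 * L * (t / (t ^ 2 + y ^ 2)) * (1 / (t ^ 2 + y ^ 2) - 2 * (t / (t ^ 2 + y ^ 2)) ^ 2)
    * deriv H (L / 2 * Real.log (t ^ 2 + y ^ 2))
  + L ^ 2 * (t / (t ^ 2 + y ^ 2)) ^ 3 * deriv (deriv H) (L / 2 * Real.log (t ^ 2 + y ^ 2))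

section derivs
variable {L y t : ℝ}

lemma hd_r : HasDerivAt (fun t : ℝ => t ^ 2 + y ^ 2) (2 * t) t := by
  simpa using (hasDerivAt_pow 2 t).add_const (y ^ 2)

lemma hd_p (h : t ^ 2 + y ^ 2 ≠ 0) : HasDerivAt (fun t : ℝ => t / (t ^ 2 + y ^ 2))
    (1 / (t ^ 2 + y ^ 2) - 2 * (t / (t ^ 2 + y ^ 2)) ^ 2) t := by
  refine ((hasDerivAt_id t).div hd_r h).congr_deriv ?_
  simp only [id]
  field_simp
  try ring

lemma hd_w (h : t ^ 2 + y ^ 2 ≠ 0) : HasDerivAt (fun t : ℝ => 1 / (t ^ 2 + y ^ 2))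
    (-2 * (t / (t ^ 2 + y ^ 2)) * (1 / (t ^ 2 + y ^ 2))) t := by
  refine ((hasDerivAt_const t (1 : ℝ)).div hd_r h).congr_deriv ?_
  field_simp
  try ring

lemma hd_s (h : t ^ 2 + y ^ 2 ≠ 0) : HasDerivAt (fun t : ℝ => L / 2 * Real.log (t ^ 2 + y ^ 2))
    (L * (t / (t ^ 2 + y ^ 2))) t := by
  refine ((hd_r.log h).const_mul (L / 2)).congr_deriv ?_
  field_simp
  try ring

lemma hd_comp {G : ℝ → ℝ} (hG : Differentiable ℝ G) (h : t ^ 2 + y ^ 2 ≠ 0) :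
    HasDerivAt (fun t : ℝ => G (L / 2 * Real.log (t ^ 2 + y ^ 2)))
    (deriv G (L / 2 * Real.log (t ^ 2 + y ^ 2)) * (L * (t / (t ^ 2 + y ^ 2)))) t :=
  HasDerivAt.comp t (hG _).hasDerivAt (hd_s h)

lemma hd_f1 {H : ℝ → ℝ} (hH : Differentiable ℝ H) (h : t ^ 2 + y ^ 2 ≠ 0) :
    HasDerivAt (fsec H L y) (fsec1 H L y t) t := by
  refine ((hd_p h).mul (hd_comp (L := L) hH h)).congr_deriv ?_
  unfold fsec1
  ring

lemma hd_f2 {H : ℝ → ℝ} (hH : Differentiable ℝ H) (hH' : Differentiable ℝ (deriv H))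
    (h : t ^ 2 + y ^ 2 ≠ 0) :
    HasDerivAt (fsec1 H L y) (fsec2 H L y t) t := by
  refine ((((hd_w h).sub (((hd_p h).pow 2).const_mul 2)).mul (hd_comp (L := L) hH h)).add
    ((((hd_p h).pow 2).const_mul L).mul (hd_comp (L := L) hH' h))).congr_deriv ?_
  unfold fsec2
  simp only [Pi.pow_apply, Pi.sub_apply, Nat.cast_ofNat]
  ring

lemma p_bound {q : ℝ} (hq : 0 < q) (h : 1 ≤ q ^ 2 * (t ^ 2 + y ^ 2)) :
    |t / (t ^ 2 + y ^ 2)| ≤ q ∧ 1 / (t ^ 2 + y ^ 2) ≤ q ^ 2 ∧ 0 < t ^ 2 + y ^ 2 := by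
  have hpos : 0 < t ^ 2 + y ^ 2 := by
    by_contra hc
    have : q ^ 2 * (t ^ 2 + y ^ 2) ≤ 0 := mul_nonpos_of_nonneg_of_nonpos (by positivity) (not_lt.1 hc)
    linarith
  refine ⟨?_, ?_, hpos⟩
  · rw [abs_div, abs_of_pos hpos, div_le_iff₀ hpos]
    apply abs_le_of_sq_le_sq _ (by positivity)
    nlinarith [sq_nonneg y]
  · rw [div_le_iff₀ hpos]; exact h

lemma f2_bound {H : ℝ → ℝ} {M q : ℝ} (hL0 : 0 ≤ L) (hL : L ≤ 2) (h0 : ∀ u, |H u| ≤ M)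
    (h1 : ∀ u, |deriv H u| ≤ M) (h2 : ∀ u, |deriv (deriv H) u| ≤ M)
    (hq : 0 < q) (h : 1 ≤ q ^ 2 * (t ^ 2 + y ^ 2)) : |fsec2 H L y t| ≤ 36 * M * q ^ 3 := by
  obtain ⟨hp, hw, hpos⟩ := p_bound hq h
  have hM : 0 ≤ M := (abs_nonneg _).trans (h0 0)
  have hw0 : 0 ≤ 1 / (t ^ 2 + y ^ 2) := by positivity
  unfold fsec2
  generalize t / (t ^ 2 + y ^ 2) = p at *
  generalize 1 / (t ^ 2 + y ^ 2) = w at *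
  generalize L / 2 * Real.log (t ^ 2 + y ^ 2) = u
  have hwa : |w| ≤ q ^ 2 := by rwa [abs_of_nonneg hw0]
  have hLa : |L| ≤ 2 := by rwa [abs_of_nonneg hL0]
  have e1 : |(-6 * p * w + 8 * p ^ 3) * H u| ≤ (6 * q * q ^ 2 + 8 * q ^ 3) * M := by
    rw [abs_mul]
    refine mul_le_mul ((abs_add_le _ _).trans ?_) (h0 u) (abs_nonneg _) (by positivity)
    rw [abs_mul, abs_mul, abs_mul, abs_pow, show |(-6 : ℝ)| = 6 by norm_num, show |(8 : ℝ)| = 8 by norm_num]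
    gcongr
  have e2 : |3 * L * p * (w - 2 * p ^ 2) * deriv H u| ≤ (3 * 2 * q * (q ^ 2 + 2 * q ^ 2)) * M := by
    rw [abs_mul]
    refine mul_le_mul ?_ (h1 u) (abs_nonneg _) (by positivity)
    rw [abs_mul, abs_mul, abs_mul, show |(3 : ℝ)| = 3 by norm_num]
    have : |w - 2 * p ^ 2| ≤ q ^ 2 + 2 * q ^ 2 := by
      refine (abs_sub _ _).trans ?_
      rw [abs_mul, abs_pow, show |(2 : ℝ)| = 2 by norm_num]
      gcongr
    gcongr
  have e3 : |L ^ 2 * p ^ 3 * deriv (deriv H) u| ≤ (2 ^ 2 * q ^ 3) * M := by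
    rw [abs_mul]
    refine mul_le_mul ?_ (h2 u) (abs_nonneg _) (by positivity)
    rw [abs_mul, abs_pow, abs_pow]
    gcongr
  refine (abs_add_le _ _).trans ((add_le_add ((abs_add_le _ _).trans (add_le_add e1 e2)) e3).trans ?_)
  apply le_of_eq
  ring

end derivs

lemma taylor2 {f f1 f2 : ℝ → ℝ} {s C : ℝ}
    (h1 : ∀ t ∈ Set.Icc (s - 1) s, HasDerivAt f (f1 t) t)
    (h2 : ∀ t ∈ Set.Icc (s - 1) s, HasDerivAt f1 (f2 t) t)
    (hC : ∀ t ∈ Set.Icc (s - 1) s, |f2 t| ≤ C) :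
    |f (s - 1) - f s + f1 s| ≤ C := by
  have hs : s ∈ Set.Icc (s - 1) s := ⟨by linarith, le_rfl⟩
  have hs1 : s - 1 ∈ Set.Icc (s - 1) s := ⟨le_rfl, by linarith⟩
  have hC0 : 0 ≤ C := (abs_nonneg _).trans (hC s hs)
  have a1 : ∀ t ∈ Set.Icc (s - 1) s, ‖f1 t - f1 s‖ ≤ C := by
    intro t ht
    have := (convex_Icc (s - 1) s).norm_image_sub_le_of_norm_hasDerivWithin_le
      (fun t ht => (h2 t ht).hasDerivWithinAt) (fun t ht => by simpa using hC t ht) hs ht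
    refine this.trans ?_
    have : ‖t - s‖ ≤ 1 := by
      rw [Real.norm_eq_abs, abs_le]; constructor <;> linarith [ht.1, ht.2]
    nlinarith
  have := (convex_Icc (s - 1) s).norm_image_sub_le_of_norm_hasDerivWithin_le
      (f := fun t => f t - f1 s * t) (f' := fun t => f1 t - f1 s)
      (fun t ht => by
        have := (h1 t ht).sub ((hasDerivAt_id t).const_mul (f1 s))
        rw [mul_one] at this
        exact this.hasDerivWithinAt) a1 hs hs1
  simp only [Real.norm_eq_abs] at this
  have e : f (s - 1) - f1 s * (s - 1) - (f s - f1 s * s) = f (s - 1) - f s + f1 s := by ring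
  rw [e] at this
  simpa using this

lemma taylor_f {H : ℝ → ℝ} {M L y s n : ℝ} (hL0 : 0 ≤ L) (hL : L ≤ 2)
    (hH : Differentiable ℝ H) (hH' : Differentiable ℝ (deriv H))
    (h0 : ∀ u, |H u| ≤ M)
    (h1 : ∀ u, |deriv H u| ≤ M) (h2 : ∀ u, |deriv (deriv H) u| ≤ M)
    (hn : 2 ≤ n) (hor : n = |s| ∨ n = |y|) :
    |fsec H L y (s - 1) - fsec H L y s + fsec1 H L y s| ≤ 972 * M / (n + 1) ^ 3 := by
  have hlow : ∀ t ∈ Set.Icc (s - 1) s, 1 ≤ (3 / (n + 1)) ^ 2 * (t ^ 2 + y ^ 2) := by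
    intro t ht
    have : ((n + 1) / 3) ^ 2 ≤ t ^ 2 + y ^ 2 := by
      rcases hor with h | h
      · have : (n + 1) / 3 ≤ |t| := by
          have : |s| ≤ |t| + 1 := by
            have e : |s - t| ≤ 1 := by rw [abs_le]; constructor <;> linarith [ht.1, ht.2]
            have := abs_sub_abs_le_abs_sub s t
            linarith
          linarith
        nlinarith [sq_abs t, sq_nonneg y]
      · have : (n + 1) / 3 ≤ |y| := by linarith
        nlinarith [sq_abs y, sq_nonneg t]
    calc (1 : ℝ) = (3 / (n + 1)) ^ 2 * ((n + 1) / 3) ^ 2 := by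
          have : n + 1 ≠ 0 := by linarith
          field_simp
      _ ≤ _ := by gcongr
  have hq : 0 < 3 / (n + 1) := by apply div_pos <;> linarith
  have hne : ∀ t ∈ Set.Icc (s - 1) s, t ^ 2 + y ^ 2 ≠ 0 := fun t ht =>
    (p_bound hq (hlow t ht)).2.2.ne'
  have := taylor2 (fun t ht => hd_f1 (L := L) hH (hne t ht))
    (fun t ht => hd_f2 (L := L) hH hH' (hne t ht))
    (fun t ht => f2_bound hL0 hL h0 h1 h2 hq (hlow t ht))
  refine this.trans (le_of_eq ?_)
  rw [div_pow]; ring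

lemma sig_eq (T : ℝ) (x : ℤ × ℤ) : sig T x = 1 / Real.log T / 2 * Real.log (nsq x) := by
  unfold sig enorm2
  have : 0 ≤ nsq x := by unfold nsq; positivity
  rw [Real.log_sqrt this]; ring

/-- first component -/
def F1 (H : ℝ → ℝ) (T : ℝ) (x : ℤ × ℤ) : ℝ := (x.1 : ℝ) / nsq x * H (sig T x)
/-- second component -/
def F2 (H : ℝ → ℝ) (T : ℝ) (x : ℤ × ℤ) : ℝ := (x.2 : ℝ) / nsq x * H (sig T x)
/-- main term -/
def F3 (H : ℝ → ℝ) (T : ℝ) (x : ℤ × ℤ) : ℝ := 1 / Real.log T * (deriv H (sig T x) / nsq x)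
/-- error -/
def Err (H : ℝ → ℝ) (T : ℝ) (x : ℤ × ℤ) : ℝ :=
  (F1 H T (x - (1, 0)) - F1 H T x) + (F2 H T (x - (0, 1)) - F2 H T x) + F3 H T x

lemma F1_eq (H : ℝ → ℝ) (T : ℝ) (x : ℤ × ℤ) : F1 H T x = fsec H (1 / Real.log T) x.2 x.1 := by
  unfold F1 fsec; rw [sig_eq]; rfl

lemma F2_eq (H : ℝ → ℝ) (T : ℝ) (x : ℤ × ℤ) : F2 H T x = fsec H (1 / Real.log T) x.1 x.2 := by
  unfold F2 fsec; rw [sig_eq]; unfold nsq; rw [add_comm]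

lemma nsq_cases (x : ℤ × ℤ) : nsq x = 0 ∨ 1 ≤ nsq x := by
  have : nsq x = ((x.1 ^ 2 + x.2 ^ 2 : ℤ) : ℝ) := by unfold nsq; push_cast; rfl
  rw [this]
  have h : 0 ≤ x.1 ^ 2 + x.2 ^ 2 := by positivity
  rcases h.eq_or_lt with h | h
  · left; rw [← h]; simp
  · right; exact_mod_cast h

lemma supn_sq_le (x : ℤ × ℤ) : (supn x : ℝ) ^ 2 ≤ nsq x := by
  unfold nsq
  rcases supn_or x with h | h <;> rw [h, sq_abs] <;> nlinarith [sq_nonneg (x.1 : ℝ), sq_nonneg (x.2 : ℝ)]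

lemma nsq_le_supn (x : ℤ × ℤ) : nsq x ≤ 2 * (supn x : ℝ) ^ 2 := by
  unfold nsq
  have h1 := pow_le_pow_left₀ (abs_nonneg _) (supn_fst x) 2
  have h2 := pow_le_pow_left₀ (abs_nonneg _) (supn_snd x) 2
  rw [sq_abs] at h1 h2
  linarith

lemma coef_le (x : ℤ × ℤ) : |(x.1 : ℝ) / nsq x| ≤ 1 ∧ |(x.2 : ℝ) / nsq x| ≤ 1 ∧ |1 / nsq x| ≤ 1 := by
  rcases nsq_cases x with h | h
  · rw [h]; simp
  · have e := (p_bound (q := 1) (t := x.1) (y := x.2) one_pos (by simpa [nsq] using h))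
    have e' := (p_bound (q := 1) (t := x.2) (y := x.1) one_pos (by simpa [nsq, add_comm] using h))
    refine ⟨e.1, ?_, ?_⟩
    · have := e'.1
      rwa [add_comm] at this
    · rw [abs_of_nonneg (by positivity)]
      simpa [nsq] using e.2.1

lemma F_bound {H : ℝ → ℝ} {M T : ℝ} (hL0 : 0 ≤ 1 / Real.log T) (hL : 1 / Real.log T ≤ 2)
    (h0 : ∀ u, |H u| ≤ M) (h1 : ∀ u, |deriv H u| ≤ M) (x : ℤ × ℤ) :
    |F1 H T x| ≤ M ∧ |F2 H T x| ≤ M ∧ |F3 H T x| ≤ 2 * M := by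
  obtain ⟨c1, c2, c3⟩ := coef_le x
  have hM : 0 ≤ M := (abs_nonneg _).trans (h0 0)
  refine ⟨?_, ?_, ?_⟩
  · unfold F1; rw [abs_mul]
    simpa using mul_le_mul c1 (h0 (sig T x)) (abs_nonneg _) zero_le_one
  · unfold F2; rw [abs_mul]
    simpa using mul_le_mul c2 (h0 (sig T x)) (abs_nonneg _) zero_le_one
  · unfold F3; rw [abs_mul, abs_of_nonneg hL0, div_eq_mul_one_div (deriv H _), abs_mul]
    have := mul_le_mul (h1 (sig T x)) c3 (abs_nonneg _) hM
    rw [mul_one] at this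
    exact mul_le_mul hL this (by positivity) (by norm_num)

lemma Err_bound {H : ℝ → ℝ} {M T : ℝ} (hL0 : 0 ≤ 1 / Real.log T) (hL : 1 / Real.log T ≤ 2)
    (hH : Differentiable ℝ H) (hH' : Differentiable ℝ (deriv H))
    (h0 : ∀ u, |H u| ≤ M) (h1 : ∀ u, |deriv H u| ≤ M) (h2 : ∀ u, |deriv (deriv H) u| ≤ M)
    (x : ℤ × ℤ) : |Err H T x| ≤ 1944 * M / ((supn x : ℝ) + 1) ^ 3 := by
  have hM : 0 ≤ M := (abs_nonneg _).trans (h0 0)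
  by_cases hn : 2 ≤ supn x
  · have hn' : (2 : ℝ) ≤ supn x := by exact_mod_cast hn
    have t1 := taylor_f hL0 hL hH hH' h0 h1 h2 hn' (supn_or x)
    have t2 := taylor_f hL0 hL hH hH' h0 h1 h2 hn' (supn_or x).symm
    have hpos : nsq x ≠ 0 := by
      have := supn_sq_le x
      nlinarith
    have e3 : fsec1 H (1 / Real.log T) x.2 x.1 + fsec1 H (1 / Real.log T) x.1 x.2 = F3 H T x := by
      unfold fsec1 F3
      rw [sig_eq]
      have e : (x.2 : ℝ) ^ 2 + (x.1 : ℝ) ^ 2 = nsq x := by unfold nsq; ring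
      have e' : (x.1 : ℝ) ^ 2 + (x.2 : ℝ) ^ 2 = nsq x := rfl
      rw [e, e']
      have k : ((x.1 : ℝ) / nsq x) ^ 2 + ((x.2 : ℝ) / nsq x) ^ 2 = 1 / nsq x := by
        rw [div_pow, div_pow, ← add_div, e']
        field_simp
      generalize (x.1 : ℝ) / nsq x = p at *
      generalize (x.2 : ℝ) / nsq x = q at *
      rw [div_eq_mul_one_div (deriv H _), ← k]
      ring
    have e4 : Err H T x = (fsec H (1 / Real.log T) x.2 (x.1 - 1) - fsec H (1 / Real.log T) x.2 x.1
          + fsec1 H (1 / Real.log T) x.2 x.1)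
        + (fsec H (1 / Real.log T) x.1 (x.2 - 1) - fsec H (1 / Real.log T) x.1 x.2
          + fsec1 H (1 / Real.log T) x.1 x.2) := by
      unfold Err
      rw [← e3, F1_eq, F1_eq, F2_eq, F2_eq]
      simp only [Prod.fst_sub, Prod.snd_sub, sub_zero, Int.cast_sub, Int.cast_one]
      ring
    rw [e4]
    refine (abs_add_le _ _).trans ((add_le_add t1 t2).trans (le_of_eq ?_))
    ring
  · have hn' : (supn x : ℝ) ≤ 1 := by
      have : supn x ≤ 1 := by omega
      exact_mod_cast this
    have hx := F_bound hL0 hL h0 h1 x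
    have hx1 := (F_bound hL0 hL h0 h1 (x - (1, 0))).1
    have hx2 := (F_bound hL0 hL h0 h1 (x - (0, 1))).2.1
    have hb : |Err H T x| ≤ 6 * M := by
      unfold Err
      have a1 := abs_le.1 hx.1
      have a2 := abs_le.1 hx.2.1
      have a3 := abs_le.1 hx.2.2
      have a4 := abs_le.1 hx1
      have a5 := abs_le.1 hx2
      rw [abs_le]
      constructor <;> linarith
    refine hb.trans ?_
    rw [le_div_iff₀ (by positivity)]
    have : ((supn x : ℝ) + 1) ^ 3 ≤ 2 ^ 3 := by gcongr; linarith
    nlinarith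

lemma log_range {a b T : ℝ} (ha : 0 < a) (hT : 2 ≤ T) {x : ℤ × ℤ} (h : sig T x ∈ Set.Icc a b) :
    T ^ a ≤ enorm2 x ∧ enorm2 x ≤ T ^ b := by
  have hlog : 0 < Real.log T := Real.log_pos (by linarith)
  have h1 : a * Real.log T ≤ Real.log (enorm2 x) := (le_div_iff₀ hlog).1 h.1
  have h2 : Real.log (enorm2 x) ≤ b * Real.log T := (div_le_iff₀ hlog).1 h.2
  have hpos : 0 < enorm2 x := by
    rcases (Real.sqrt_nonneg (nsq x)).eq_or_lt with h0 | h0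
    · exfalso
      have : enorm2 x = 0 := h0.symm
      rw [this, Real.log_zero] at h1
      have := mul_pos ha hlog
      linarith
    · exact h0
  have hT0 : 0 < T := by linarith
  constructor
  · rw [Real.rpow_def_of_pos hT0, mul_comm, ← Real.le_log_iff_exp_le hpos]; exact h1
  · rw [Real.rpow_def_of_pos hT0, mul_comm, ← Real.log_le_iff_le_exp hpos]; exact h2

lemma supn_range {a b T : ℝ} (ha : 0 < a) (hT : 2 ≤ T) {x : ℤ × ℤ} (h : sig T x ∈ Set.Icc a b) :
    T ^ a ≤ 2 * (supn x : ℝ) ∧ (supn x : ℝ) ≤ T ^ b := by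
  obtain ⟨h1, h2⟩ := log_range ha hT h
  have hx0 : 0 ≤ nsq x := by unfold nsq; positivity
  constructor
  · refine h1.trans ?_
    unfold enorm2
    rw [Real.sqrt_le_left (by positivity)]
    have := nsq_le_supn x
    nlinarith [sq_nonneg (supn x : ℝ)]
  · refine le_trans ?_ h2
    exact Real.le_sqrt_of_sq_le (supn_sq_le x)

lemma supn_sub (x : ℤ × ℤ) : supn (x - (1, 0)) ≤ supn x + 1 ∧ supn (x - (0, 1)) ≤ supn x + 1 := by
  unfold supn
  simp only [Prod.fst_sub, Prod.snd_sub]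
  omega

lemma F_supp {H : ℝ → ℝ} {a b T : ℝ} (hsupp : tsupport H ⊆ Set.Icc a b) {x : ℤ × ℤ}
    (h : F1 H T x ≠ 0 ∨ F2 H T x ≠ 0 ∨ F3 H T x ≠ 0) : sig T x ∈ Set.Icc a b := by
  apply hsupp
  have hd : deriv H (sig T x) ≠ 0 → sig T x ∈ tsupport H := fun h =>
    support_deriv_subset h
  have hh : H (sig T x) ≠ 0 → sig T x ∈ tsupport H := fun h => subset_tsupport _ h
  rcases h with h | h | h
  · exact hh (fun e => h (by unfold F1; rw [e, mul_zero]))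
  · exact hh (fun e => h (by unfold F2; rw [e, mul_zero]))
  · exact hd (fun e => h (by unfold F3; rw [e, zero_div, mul_zero]))

lemma Err_supp {H : ℝ → ℝ} {a b T : ℝ} (ha : 0 < a) (hT : 2 ≤ T) (hsupp : tsupport H ⊆ Set.Icc a b)
    {x : ℤ × ℤ} (h : Err H T x ≠ 0) : T ^ a ≤ 2 * ((supn x : ℝ) + 1) := by
  by_contra hc
  apply h
  have s1 : (supn (x - (1, 0)) : ℝ) ≤ supn x + 1 := by exact_mod_cast (supn_sub x).1
  have s2 : (supn (x - (0, 1)) : ℝ) ≤ supn x + 1 := by exact_mod_cast (supn_sub x).2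
  have z1 : F1 H T (x - (1, 0)) = 0 := by
    by_contra h0
    have := (supn_range ha hT (F_supp hsupp (Or.inl h0))).1
    exact hc (by linarith)
  have z2 : F2 H T (x - (0, 1)) = 0 := by
    by_contra h0
    have := (supn_range ha hT (F_supp hsupp (Or.inr (Or.inl h0)))).1
    exact hc (by linarith)
  have z3 : F1 H T x = 0 := by
    by_contra h0
    have := (supn_range ha hT (F_supp hsupp (Or.inl h0))).1
    exact hc (by linarith)
  have z4 : F2 H T x = 0 := by
    by_contra h0
    have := (supn_range ha hT (F_supp hsupp (Or.inr (Or.inl h0)))).1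
    exact hc (by linarith)
  have z5 : F3 H T x = 0 := by
    by_contra h0
    have := (supn_range ha hT (F_supp hsupp (Or.inr (Or.inr h0)))).1
    exact hc (by linarith)
  unfold Err
  rw [z1, z2, z3, z4, z5]; ring

lemma fin_supn (c : ℝ) : {x : ℤ × ℤ | (supn x : ℝ) ≤ c}.Finite := by
  obtain ⟨N, hN⟩ := exists_nat_ge c
  refine (Set.Finite.prod (Set.finite_Icc (-(N : ℤ)) N) (Set.finite_Icc (-(N : ℤ)) N)).subset ?_
  intro x hx
  have h : supn x ≤ N := by
    have : (supn x : ℝ) ≤ N := le_trans hx hN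
    exact_mod_cast this
  unfold supn at h
  simp only [Set.mem_prod, Set.mem_Icc]
  omega

lemma bounded_of {G : ℝ → ℝ} (hc : Continuous G) (hs : HasCompactSupport G) :
    ∃ M, ∀ u, |G u| ≤ M := hs.exists_bound_of_continuous hc

lemma key_sum {H : ℝ → ℝ} {T : ℝ} {η : ℤ × ℤ → ℝ}
    (f1 : (Function.support (F1 H T)).Finite) (f2 : (Function.support (F2 H T)).Finite)
    (f3 : (Function.support (F3 H T)).Finite) :
    ∃ S : Finset (ℤ × ℤ), 
    ((∑' x, F1 H T x * (η (x + (1, 0)) - η x)) + ∑' x, F2 H T x * (η (x + (0, 1)) - η x))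
      + ∑' x, η x * F3 H T x = ∑ x ∈ S, η x * Err H T x := by
  have shift : ∀ (F : ℤ × ℤ → ℝ) (v : ℤ × ℤ), (Function.support F).Finite →
      Summable (fun x => η x * (F (x - v) - F x)) ∧
      ∑' x, F x * (η (x + v) - η x) = ∑' x, η x * (F (x - v) - F x) := by
    intro F v hF
    have sA : Summable (fun x => F x * η (x + v)) :=
      summable_of_hasFiniteSupport (hF.subset (fun x hx h0 => hx (by simp [h0])))
    have sB : Summable (fun x => F x * η x) :=
      summable_of_hasFiniteSupport (hF.subset (fun x hx h0 => hx (by simp [h0])))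
    have sC : Summable (fun x => F (x - v) * η x) := by
      rw [← (Equiv.addRight v).summable_iff]
      simpa [Function.comp_def] using sA
    have eC : ∑' x, F (x - v) * η x = ∑' x, F x * η (x + v) := by
      rw [← (Equiv.addRight v).tsum_eq]
      simp
    constructor
    · refine (sC.sub sB).congr (fun x => by ring)
    · calc _ = ∑' x, (F x * η (x + v) - F x * η x) := tsum_congr (fun x => by ring)
        _ = ∑' x, (F (x - v) * η x - F x * η x) := by
            rw [sA.tsum_sub sB, sC.tsum_sub sB, eC]
        _ = _ := tsum_congr (fun x => by ring)
  obtain ⟨s1, e1⟩ := shift (F1 H T) (1, 0) f1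
  obtain ⟨s2, e2⟩ := shift (F2 H T) (0, 1) f2
  have s3 : Summable (fun x => η x * F3 H T x) :=
    summable_of_hasFiniteSupport (f3.subset (fun x hx h0 => hx (by simp [h0])))
  have ff : (Function.support (Err H T)).Finite := by
    have g1 : (Function.support (fun x => F1 H T (x - (1, 0)))).Finite :=
      f1.preimage (f := fun x => x - ((1, 0) : ℤ × ℤ)) (sub_left_injective.injOn)
    have g2 : (Function.support (fun x => F2 H T (x - (0, 1)))).Finite :=
      f2.preimage (f := fun x => x - ((0, 1) : ℤ × ℤ)) (sub_left_injective.injOn)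
    refine ((((g1.union f1).union g2).union f2).union f3).subset ?_
    intro x hx
    by_contra hc
    simp only [Set.mem_union, Function.mem_support, not_or, not_not] at hc
    apply hx
    unfold Err
    rw [hc.1.1.1.1, hc.1.1.1.2, hc.1.1.2, hc.1.2, hc.2]; ring
  refine ⟨ff.toFinset, ?_⟩
  rw [e1, e2, ← s1.tsum_add s2, ← (s1.add s2).tsum_add s3]
  rw [← tsum_eq_sum (L := SummationFilter.unconditional _) (s := ff.toFinset)
    (f := fun x => η x * Err H T x)]
  · exact tsum_congr (fun x => by unfold Err; ring)
  · intro x hx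
    have : Err H T x = 0 := by simpa using hx
    rw [this, mul_zero]

/-- Summation by parts for the polar empirical measure: the discrete gradient sum
`Σ_j Σ_x (x_j/|x|²) H(σ_T(x)) [η(x+e_j) - η(x)]` equals
`-2π ∫ H' dμ^{1,T}(η) = -(1/log T) Σ_x η(x) H'(σ_T(x))/|x|²`
up to an error bounded by `C₀ T^{-a}`, uniformly in the configuration `η`. -/
theorem stmt13 (a b : ℝ) (ha : 0 < a) (hab : a < b)
    (H : ℝ → ℝ) (hH : ContDiff ℝ 2 H) (hsupp : tsupport H ⊆ Set.Icc a b) :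
    ∃ C₀ : ℝ, ∀ T : ℝ, 2 ≤ T →
      ∀ η : ℤ × ℤ → ℝ, (∀ x, η x = 0 ∨ η x = 1) →
        |((∑' x : ℤ × ℤ,
            if x ≠ 0 then ((x.1 : ℝ) / nsq x) * H (sig T x) * (η (x + (1, 0)) - η x)
            else 0)
          + ∑' x : ℤ × ℤ,
              if x ≠ 0 then ((x.2 : ℝ) / nsq x) * H (sig T x) * (η (x + (0, 1)) - η x)
              else 0)
          + (1 / Real.log T) *
              (∑' x : ℤ × ℤ,
                if x ≠ 0 then η x * deriv H (sig T x) / nsq x else 0)|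
          ≤ C₀ * T ^ (-a) := by
  have hcs : HasCompactSupport H := isCompact_Icc.of_isClosed_subset (isClosed_tsupport H) hsupp
  have hH1 : ContDiff ℝ 1 (deriv H) := by
    have : ContDiff ℝ (1 + 1) H := by simpa [one_add_one_eq_two] using hH
    exact (contDiff_succ_iff_deriv.1 this).2.2
  have hd : Differentiable ℝ H := hH.differentiable (by norm_num)
  have hd1 : Differentiable ℝ (deriv H) := hH1.differentiable (by norm_num)
  obtain ⟨M0, h0⟩ := bounded_of hH.continuous hcs
  obtain ⟨M1, h1⟩ := bounded_of hH1.continuous hcs.deriv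
  obtain ⟨M2, h2⟩ := bounded_of (hH1.continuous_deriv le_rfl) hcs.deriv.deriv
  obtain ⟨M, b0, b1, b2⟩ : ∃ M, M0 ≤ M ∧ M1 ≤ M ∧ M2 ≤ M :=
    ⟨max M0 (max M1 M2), le_max_left _ _, (le_max_left _ _).trans (le_max_right _ _),
      (le_max_right _ _).trans (le_max_right _ _)⟩
  replace h0 := fun u => (h0 u).trans b0
  replace h1 := fun u => (h1 u).trans b1
  replace h2 := fun u => (h2 u).trans b2
  have hM : 0 ≤ M := (abs_nonneg _).trans (h0 0)
  refine ⟨32 * (1944 * M), ?_⟩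
  intro T hT η hη
  have hlog2 : 1 / 2 ≤ Real.log T := by
    have : Real.log 2 ≤ Real.log T := Real.log_le_log (by norm_num) hT
    have := Real.log_two_gt_d9
    linarith
  have hL0 : 0 ≤ 1 / Real.log T := by
    apply div_nonneg <;> linarith
  have hL : 1 / Real.log T ≤ 2 := by
    rw [div_le_iff₀ (by linarith)]; linarith
  have fin : ∀ F : ℤ × ℤ → ℝ, (∀ x, F x ≠ 0 → sig T x ∈ Set.Icc a b) →
      (Function.support F).Finite := fun F hF =>
    (fin_supn (T ^ b)).subset (fun x hx => (supn_range ha hT (hF x hx)).2)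
  obtain ⟨S, hS⟩ := key_sum (η := η)
    (fin (F1 H T) (fun x h => F_supp hsupp (Or.inl h)))
    (fin (F2 H T) (fun x h => F_supp hsupp (Or.inr (Or.inl h))))
    (fin (F3 H T) (fun x h => F_supp hsupp (Or.inr (Or.inr h))))
  have r1 : (∑' x : ℤ × ℤ,
            if x ≠ 0 then ((x.1 : ℝ) / nsq x) * H (sig T x) * (η (x + (1, 0)) - η x)
            else 0) = ∑' x, F1 H T x * (η (x + (1, 0)) - η x) := by
    refine tsum_congr (fun x => ?_)
    split_ifs with h
    · rfl
    · have : x = 0 := not_not.1 h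
      subst this
      simp [F1]
  have r2 : (∑' x : ℤ × ℤ,
            if x ≠ 0 then ((x.2 : ℝ) / nsq x) * H (sig T x) * (η (x + (0, 1)) - η x)
            else 0) = ∑' x, F2 H T x * (η (x + (0, 1)) - η x) := by
    refine tsum_congr (fun x => ?_)
    split_ifs with h
    · rfl
    · have : x = 0 := not_not.1 h
      subst this
      simp [F2]
  have r3 : (1 / Real.log T) * (∑' x : ℤ × ℤ,
                if x ≠ 0 then η x * deriv H (sig T x) / nsq x else 0) =
      ∑' x, η x * F3 H T x := by
    rw [← tsum_mul_left]
    refine tsum_congr (fun x => ?_)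
    split_ifs with h
    · unfold F3; ring
    · have : x = 0 := not_not.1 h
      subst this
      simp [F3, nsq]
  rw [r1, r2, r3, hS]
  have hTa : 0 < T ^ a := Real.rpow_pos_of_pos (by linarith) a
  have := tail (Err H T) (1944 * M) (T ^ a) (by positivity) hTa
    (Err_bound hL0 hL hd hd1 h0 h1 h2) (fun x h => Err_supp ha hT hsupp h) S
  rw [Real.rpow_neg (by linarith), ← div_eq_mul_inv]
  refine le_trans ((Finset.abs_sum_le_sum_abs _ _).trans (Finset.sum_le_sum (fun x _ => ?_))) this
  rw [abs_mul]
  have : |η x| ≤ 1 := by rcases hη x with h | h <;> rw [h] <;> simp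
  exact mul_le_of_le_one_left (abs_nonneg _) this
end
end
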